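/- Let G be a minimally 3-connected braced polygonal circuit on n vertices. Then the vertices of degree 3 in G form a consecutive segment on the boundary polygon. -/

import Mathlib

/-- A boundary edge of the `n`-gon: an edge of the form `{i, i+1}`. -/
def IsBoundaryEdge (n : ℕ) (e : Sym2 (ZMod n)) : Prop := ∃ i : ZMod n, e = s(i, i + 1)

/-- The braced polygon graph on the cyclically ordered vertex set `ZMod n`:
the boundary Hamilton cycle `{i, i+1}` together with the set `B` of braces. -/
def bpGraph (n : ℕ) (B : Finset (Sym2 (ZMod n))) : SimpleGraph (ZMod n) :=
  SimpleGraph.fromEdgeSet ((↑B : Set (Sym2 (ZMod n))) ∪ {e | IsBoundaryEdge n e})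

/-- A graph is 3-connected if it has at least 4 vertices and deleting any
at most 2 vertices leaves it connected. -/
def ThreeConnected {V : Type*} [Fintype V] (G : SimpleGraph V) : Prop :=
  4 ≤ Fintype.card V ∧
    ∀ s : Finset V, s.card ≤ 2 → (G.induce ((↑s : Set V)ᶜ)).Connected

/-- A braced polygon graph is minimally 3-connected if it is 3-connected and
deleting any brace destroys 3-connectivity. -/
def MinThreeConnectedBP (n : ℕ) [NeZero n] (B : Finset (Sym2 (ZMod n))) : Prop :=
  ThreeConnected (bpGraph n B) ∧ ∀ e ∈ B, ¬ ThreeConnected (bpGraph n (B.erase e))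

namespace BracedPolygon

open scoped Classical

variable {V : Type*}

/-- The points `x`, `y` separate `a` from `b`, where the integer line is closed up to a circle. -/
def Cross (x y a b : ℤ) : Prop :=
  ((x < a ∧ a < y ∨ y < a ∧ a < x) ∧ (b < x ∧ b < y ∨ x < b ∧ y < b)) ∨
  ((x < b ∧ b < y ∨ y < b ∧ b < x) ∧ (a < x ∧ a < y ∨ x < a ∧ y < a))

/-- The separation relation `cr` is induced by the injective numbering `k`. -/
structure IsKey (cr : V → V → V → V → Prop) (k : V → ℤ) : Prop where
  inj : Function.Injective k
  iff : ∀ x y a b, cr x y a b ↔ Cross (k x) (k y) (k a) (k b)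

/-- `cr` is the separation relation of some cyclic ordering. -/
def IsSep (cr : V → V → V → V → Prop) : Prop := ∃ k, IsKey cr k

/-- Every pair of points of `S` that separates `S` is crossed by a brace of `B`. -/
def Crossed (cr : V → V → V → V → Prop) (S : Finset V) (B : Finset (Sym2 V)) : Prop :=
  ∀ x ∈ S, ∀ y ∈ S, (∃ p ∈ S, ∃ q ∈ S, cr x y p q) → ∃ p q, s(p, q) ∈ B ∧ cr x y p q

/-- `B` is a set of diagonals of the polygon `S` that makes it 3-connected. -/
structure Braced (cr : V → V → V → V → Prop) (S : Finset V) (B : Finset (Sym2 V)) : Prop where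
  card : 4 ≤ S.card
  mem : ∀ p q, s(p, q) ∈ B → p ∈ S
  diag : ∀ p q, s(p, q) ∈ B → ∃ u ∈ S, ∃ v ∈ S, cr p q u v
  crossed : Crossed cr S B

/-- `s(p, q)` is the only brace crossing the pair `x`, `y`. -/
def Private (cr : V → V → V → V → Prop) (B : Finset (Sym2 V)) (x y p q : V) : Prop :=
  cr x y p q ∧ ∀ p' q', s(p', q') ∈ B → cr x y p' q' → s(p', q') = s(p, q)

/-- All members of `E` are essential braces. -/
def Essential (cr : V → V → V → V → Prop) (S : Finset V) (B E : Finset (Sym2 V)) : Prop :=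
  ∀ p q, s(p, q) ∈ E → ∃ x ∈ S, ∃ y ∈ S, Private cr B x y p q

/-- `v` lies on at most one brace. -/
def Leaf (B : Finset (Sym2 V)) (v : V) : Prop :=
  ∀ w w', s(v, w) ∈ B → s(v, w') ∈ B → w = w'

/-- The leaves are not separated by non-leaves. -/
def LeavesConsecutive (cr : V → V → V → V → Prop) (S : Finset V) (B : Finset (Sym2 V)) : Prop :=
  ∀ u ∈ S, ∀ v ∈ S, ∀ p ∈ S, ∀ q ∈ S, cr u v p q →
    ¬ Leaf B u → ¬ Leaf B v → Leaf B p → Leaf B q → False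

/-- The bound on the number of essential braces, and the structure in the extremal case. -/
def EssentialBound (cr : V → V → V → V → Prop) (S : Finset V) (B E : Finset (Sym2 V)) : Prop :=
  E.card + 2 ≤ S.card ∧ (E.card + 2 = S.card → E = B ∧ LeavesConsecutive cr S B)

/-- The brace `s(a, c)` is the only one crossing the pair `x`, `y`. -/
structure Cut (cr : V → V → V → V → Prop) (S : Finset V) (B : Finset (Sym2 V))
    (x y a c : V) : Prop where
  left : x ∈ S
  right : y ∈ S
  brace : s(a, c) ∈ B
  priv : Private cr B x y a c

/-- The polygon on the points not on the side of `a`, together with `a`. -/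
noncomputable def sideV (cr : V → V → V → V → Prop) (S : Finset V) (x y a : V) : Finset V :=
  S.filter fun v => v = x ∨ v = y ∨ v = a ∨ cr x y a v

/-- The braces not meeting the side of `a`. -/
noncomputable def sideE (cr : V → V → V → V → Prop) (B : Finset (Sym2 V)) (x y a : V) :
    Finset (Sym2 V) :=
  B.filter fun f => ∀ v ∈ f, v = x ∨ v = y ∨ cr x y a v

variable {cr : V → V → V → V → Prop} {S : Finset V} {B E : Finset (Sym2 V)} {x y a c : V}

lemma mem_sideV {v : V} :
    v ∈ sideV cr S x y a ↔ v ∈ S ∧ (v = x ∨ v = y ∨ v = a ∨ cr x y a v) := by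
  simp [sideV]

lemma mem_sideE {p q : V} : s(p, q) ∈ sideE cr B x y a ↔
    s(p, q) ∈ B ∧ (p = x ∨ p = y ∨ cr x y a p) ∧ (q = x ∨ q = y ∨ cr x y a q) := by
  simp [sideE]

lemma IsKey.rotate [Finite V] {k : V → ℤ} (hk : IsKey cr k) (x : V) :
    ∃ k', IsKey cr k' ∧ (∀ v, k' x ≤ k' v) ∧
      ∀ u v, k u < k x → k v < k x → k u < k v → k' u < k' v := by
  obtain ⟨M, hM⟩ := (Set.finite_range k).bddAbove
  obtain ⟨m, hm⟩ := (Set.finite_range k).bddBelow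
  have hM' : ∀ v, k v ≤ M := fun v => hM ⟨v, rfl⟩
  have hm' : ∀ v, m ≤ k v := fun v => hm ⟨v, rfl⟩
  refine ⟨fun v => if k v < k x then k v + (M - m + 1) else k v, ⟨?_, ?_⟩, ?_, ?_⟩
  · intro u v huv
    apply hk.inj
    have := hM' u; have := hM' v; have := hm' u; have := hm' v
    simp only at huv
    split_ifs at huv <;> omega
  · intro u v p q
    rw [hk.iff]
    have := hM' u; have := hM' v; have := hm' u; have := hm' v
    have := hM' p; have := hM' q; have := hm' p; have := hm' q
    unfold Cross
    split_ifs <;> omega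
  · intro v
    have := hM' v; have := hm' v; have := hM' x
    simp only [lt_irrefl, if_false]
    split_ifs <;> omega
  · intro u v hu hv huv
    simp only [hu, hv, if_true]
    omega

lemma IsKey.neg {k : V → ℤ} (h : IsKey cr k) : IsKey cr (fun v => - k v) := by
  refine ⟨fun u v huv => h.inj (by simpa using huv), fun u v p q => ?_⟩
  rw [h.iff]
  unfold Cross
  omega

lemma IsSep.exists_key_min [Finite V] (h : IsSep cr) (x : V) :
    ∃ k, IsKey cr k ∧ ∀ v, k x ≤ k v := by
  obtain ⟨k, hk⟩ := h
  obtain ⟨k', h1, h2, -⟩ := hk.rotate x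
  exact ⟨k', h1, h2⟩

lemma IsSep.exists_key [Finite V] (h : IsSep cr) (hx : cr x y a c) :
    ∃ k, IsKey cr k ∧ (∀ v, k x ≤ k v) ∧ k x < k a ∧ k a < k y ∧ k y < k c := by
  obtain ⟨k, hk, hmin⟩ := h.exists_key_min x
  have h1 := (hk.iff _ _ _ _).1 hx
  have h2 := hmin a; have h3 := hmin c; have h4 := hmin y
  unfold Cross at h1
  by_cases hay : k a < k y
  · exact ⟨k, hk, hmin, by omega⟩
  · obtain ⟨k', hk', hmin', hlt⟩ := hk.neg.rotate x
    have h1' := (hk'.iff _ _ _ _).1 hx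
    have h2' := hmin' a; have h3' := hmin' c; have h4' := hmin' y
    have h5 := hlt a y (by omega) (by omega) (by omega)
    unfold Cross at h1'
    exact ⟨k', hk', hmin', by omega⟩

lemma IsSep.swap_left (h : IsSep cr) {x y a b : V} : cr x y a b ↔ cr y x a b := by
  obtain ⟨k, hk⟩ := h
  rw [hk.iff, hk.iff]; unfold Cross; omega

lemma IsSep.swap_right (h : IsSep cr) {x y a b : V} : cr x y a b ↔ cr x y b a := by
  obtain ⟨k, hk⟩ := h
  rw [hk.iff, hk.iff]; unfold Cross; omega

lemma Braced.mem_right (hB : Braced cr S B) {p q : V} (h : s(p, q) ∈ B) : q ∈ S :=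
  hB.mem q p (by rwa [Sym2.eq_swap])

lemma Braced.ne (hs : IsSep cr) (hB : Braced cr S B) {p q : V} (h : s(p, q) ∈ B) : p ≠ q := by
  rintro rfl
  obtain ⟨k, hk⟩ := hs
  obtain ⟨u, -, v, -, huv⟩ := hB.diag _ _ h
  rw [hk.iff] at huv
  unfold Cross at huv; omega

lemma Braced.exists_neighbors [Finite V] (hs : IsSep cr) (hB : Braced cr S B) {v : V}
    (hv : v ∈ S) : ∃ z ∈ S, ∃ w ∈ S, z ≠ v ∧ w ≠ v ∧ s(v, z) ∉ B ∧ (∃ u ∈ S, cr z w v u) ∧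
      (∀ p q, s(p, q) ∈ B → cr z w p q → p = v ∨ q = v) ∧ ∀ u, s(v, u) ∈ B → cr z w v u := by
  obtain ⟨k, hk, hmin⟩ := hs.exists_key_min v
  have hc : 3 ≤ (S.erase v).card := by
    rw [Finset.card_erase_of_mem hv]; have := hB.card; omega
  have hne : (S.erase v).Nonempty := Finset.card_pos.1 (by omega)
  obtain ⟨z, hz, hz'⟩ := Finset.exists_min_image _ k hne
  obtain ⟨w, hw, hw'⟩ := Finset.exists_max_image _ k hne
  have hlt : ∀ u, u ≠ v → k v < k u := fun u hu =>
    lt_of_le_of_ne (hmin u) (fun h => hu (hk.inj h.symm))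
  obtain ⟨u, hu⟩ : (((S.erase v).erase z).erase w).Nonempty := by
    apply Finset.card_pos.1
    have := Finset.pred_card_le_card_erase (s := S.erase v) (a := z)
    have := Finset.pred_card_le_card_erase (s := (S.erase v).erase z) (a := w)
    omega
  simp only [Finset.mem_erase] at hz hw hu hz' hw'
  have cross : ∀ u ∈ S, u ≠ v → u ≠ z → u ≠ w → cr z w v u := by
    intro u hu h1 h2 h3
    rw [hk.iff]
    have := hz' u ⟨h1, hu⟩; have := hw' u ⟨h1, hu⟩
    have : k u ≠ k z := fun h => h2 (hk.inj h)
    have : k u ≠ k w := fun h => h3 (hk.inj h)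
    have := hlt u h1; have := hlt z hz.1
    unfold Cross; omega
  have hval : ∀ u, s(v, u) ∈ B → u ≠ v ∧ u ≠ z ∧ u ≠ w := by
    intro u hu
    obtain ⟨p, hp, q, hq, hpq⟩ := hB.diag _ _ hu
    rw [hk.iff] at hpq
    have e1 : p ≠ v := by
      rintro rfl; unfold Cross at hpq; omega
    have e2 : q ≠ v := by
      rintro rfl; unfold Cross at hpq; omega
    have := hlt p e1; have := hlt q e2
    have := hz' p ⟨e1, hp⟩; have := hw' p ⟨e1, hp⟩
    have := hz' q ⟨e2, hq⟩; have := hw' q ⟨e2, hq⟩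
    refine ⟨?_, ?_, ?_⟩ <;> rintro rfl <;> unfold Cross at hpq <;> omega
  refine ⟨z, hz.2, w, hw.2, hz.1, hw.1, fun h => (hval z h).2.1 rfl,
    ⟨u, hu.2.2.2, cross u hu.2.2.2 hu.2.2.1 hu.2.1 hu.1⟩, ?_, fun u hu => ?_⟩
  · intro p q hpq hcr
    by_contra! hne
    have hp := hB.mem _ _ hpq
    have hq := hB.mem_right hpq
    rw [hk.iff] at hcr
    have := hz' p ⟨hne.1, hp⟩; have := hw' p ⟨hne.1, hp⟩
    have := hz' q ⟨hne.2, hq⟩; have := hw' q ⟨hne.2, hq⟩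
    unfold Cross at hcr; omega
  · have h := hval u hu
    exact cross u (hB.mem_right hu) h.1 h.2.1 h.2.2

lemma Braced.exists_brace [Finite V] (hs : IsSep cr) (hB : Braced cr S B) {v : V} (hv : v ∈ S) :
    ∃ w, s(v, w) ∈ B := by
  obtain ⟨z, hz, w, hw, -, -, -, ⟨u, hu, hcr⟩, h, -⟩ := hB.exists_neighbors hs hv
  obtain ⟨p, q, hpq, hcr'⟩ := hB.crossed z hz w hw ⟨v, hv, u, hu, hcr⟩
  rcases h p q hpq hcr' with rfl | rfl
  · exact ⟨q, hpq⟩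
  · exact ⟨p, by rwa [Sym2.eq_swap]⟩

lemma Private.symm (hs : IsSep cr) {p q : V} (h : Private cr B x y p q) :
    Private cr B x y q p :=
  ⟨hs.swap_right.1 h.1, fun p' q' hpq hcr => (h.2 p' q' hpq hcr).trans Sym2.eq_swap⟩

lemma Private.swap (hs : IsSep cr) {p q : V} (h : Private cr B x y p q) :
    Private cr B y x p q :=
  ⟨hs.swap_left.1 h.1, fun p' q' hpq hcr => h.2 p' q' hpq (hs.swap_left.1 hcr)⟩

lemma Private.mono {B' : Finset (Sym2 V)} (hB : B' ⊆ B) {p q : V} (h : Private cr B x y p q) :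
    Private cr B' x y p q :=
  ⟨h.1, fun p' q' hpq hcr => h.2 p' q' (hB hpq) hcr⟩

lemma Leaf.mono {B' : Finset (Sym2 V)} (hB : B' ⊆ B) {v : V} (h : Leaf B v) : Leaf B' v :=
  fun w w' h1 h2 => h w w' (hB h1) (hB h2)

lemma Braced.private_of_leaf [Finite V] (hs : IsSep cr) (hB : Braced cr S B) {p q : V}
    (hp : Leaf B p) (hpq : s(p, q) ∈ B) : ∃ z ∈ S, ∃ w ∈ S, Private cr B z w p q := by
  obtain ⟨z, hz, w, hw, -, -, -, -, h, h'⟩ := hB.exists_neighbors hs (hB.mem _ _ hpq)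
  refine ⟨z, hz, w, hw, h' q hpq, fun p' q' hpq' hcr => ?_⟩
  rcases h p' q' hpq' hcr with rfl | rfl
  · rw [hp _ _ hpq hpq']
  · rw [Sym2.eq_swap] at hpq' ⊢
    rw [hp _ _ hpq hpq']

/-- Braces with a leaf among their ends are at most as many as the available leaves. -/
lemma card_le_of_leaf {L : Finset V} (hE : E ⊆ B) (hL : ∀ v ∈ L, Leaf B v)
    (h : ∀ p q, s(p, q) ∈ E → p ∈ L ∨ q ∈ L) : E.card ≤ L.card := by
  have h' : ∀ e ∈ E, ∃ v ∈ L, v ∈ e := by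
    intro e
    induction e with | _ p q
    intro he
    rcases h p q he with hp | hq
    · exact ⟨p, hp, by simp⟩
    · exact ⟨q, hq, by simp⟩
  refine Finset.card_le_card_of_forall_subsingleton (fun e v => v ∈ e) h' fun v hv => ?_
  rintro e ⟨he, w, rfl⟩ e' ⟨he', w', rfl⟩
  rw [hL v hv _ _ (hE he) (hE he')]

/-- The bound when no essential brace joins two non-leaves. -/
lemma essentialBound_of_leaf [Finite V] (hs : IsSep cr) (hB : Braced cr S B) (hE : E ⊆ B)
    (h : ∀ p q, s(p, q) ∈ E → Leaf B p ∨ Leaf B q) : EssentialBound cr S B E := by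
  have hcard := hB.card
  by_cases hbig : ∃ u ∈ S, ∃ v ∈ S, u ≠ v ∧ ¬ Leaf B u ∧ ¬ Leaf B v
  · obtain ⟨u, hu, v, hv, huv, hub, hvb⟩ := hbig
    set L := S.filter fun w => Leaf B w with hLdef
    have hLS : L ⊆ (S.erase u).erase v := by
      intro w hw
      simp only [hLdef, Finset.mem_filter] at hw
      simp only [Finset.mem_erase]
      exact ⟨by rintro rfl; exact hvb hw.2, by rintro rfl; exact hub hw.2, hw.1⟩
    have hL2 : ((S.erase u).erase v).card + 2 = S.card := by
      rw [Finset.card_erase_of_mem (Finset.mem_erase.2 ⟨huv.symm, hv⟩), Finset.card_erase_of_mem hu]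
      omega
    have hLc := Finset.card_le_card hLS
    have hEL : E.card ≤ L.card := by
      refine card_le_of_leaf hE (fun w hw => (Finset.mem_filter.1 hw).2) fun p q hpq => ?_
      simp only [hLdef, Finset.mem_filter]
      exact (h p q hpq).imp (fun hp => ⟨hB.mem _ _ (hE hpq), hp⟩)
        (fun hq => ⟨hB.mem_right (hE hpq), hq⟩)
    refine ⟨by omega, fun heq => ?_⟩
    have hLeq : L = (S.erase u).erase v := Finset.eq_of_subset_of_card_le hLS (by omega)
    have big : ∀ w ∈ S, ¬ Leaf B w → w = u ∨ w = v := by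
      intro w hw hwb
      by_contra! hne
      have : w ∈ L := by rw [hLeq]; simp [hne, hw]
      exact hwb (Finset.mem_filter.1 this).2
    have lessL : ∀ w ∈ L, ¬ ∀ p q, s(p, q) ∈ E → p ∈ L.erase w ∨ q ∈ L.erase w := by
      intro w hw hcon
      have := card_le_of_leaf (L := L.erase w) hE
        (fun w' hw' => (Finset.mem_filter.1 (Finset.mem_of_mem_erase hw')).2) hcon
      rw [Finset.card_erase_of_mem hw] at this
      have : 0 < L.card := Finset.card_pos.2 ⟨w, hw⟩
      omega
    have memL : ∀ w, w ∈ L ↔ w ∈ S ∧ Leaf B w := fun w => by simp [hLdef]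
    have covered : ∀ w w', s(w, w') ∈ B → Leaf B w → s(w, w') ∈ E := by
      intro w w' hww hw
      by_contra hnot
      apply lessL w ((memL w).2 ⟨hB.mem _ _ hww, hw⟩)
      intro p q hpq
      simp only [Finset.mem_erase, memL]
      have hp := hB.mem _ _ (hE hpq)
      have hq := hB.mem_right (hE hpq)
      have hpw : p ≠ w := by
        rintro rfl; exact hnot (hw _ _ hww (hE hpq) ▸ hpq)
      have hqw : q ≠ w := by
        rintro rfl
        rw [Sym2.eq_swap] at hpq
        exact hnot (hw _ _ hww (hE hpq) ▸ hpq)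
      exact (h p q hpq).imp (fun h => ⟨hpw, hp, h⟩) (fun h => ⟨hqw, hq, h⟩)
    have noLL : ∀ p q, s(p, q) ∈ B → Leaf B p → Leaf B q → False := by
      intro p q hpq hp hq
      have hne := hB.ne hs hpq
      apply lessL p ((memL p).2 ⟨hB.mem _ _ hpq, hp⟩)
      intro p' q' hpq'
      simp only [Finset.mem_erase, memL]
      have hp' := hB.mem _ _ (hE hpq')
      have hq' := hB.mem_right (hE hpq')
      by_cases h1 : p' = p
      · subst h1
        obtain rfl := hp _ _ hpq (hE hpq')
        exact .inr ⟨hne.symm, hq', hq⟩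
      by_cases h2 : q' = p
      · subst h2
        obtain rfl := hp _ _ hpq (Sym2.eq_swap ▸ hE hpq')
        exact .inl ⟨hne.symm, hp', hq⟩
      exact (h p' q' hpq').imp (fun h => ⟨h1, hp', h⟩) (fun h => ⟨h2, hq', h⟩)
    have nodiag : ¬ ∃ p ∈ S, ∃ q ∈ S, cr u v p q := by
      intro hd
      obtain ⟨p, q, hpq, hcr⟩ := hB.crossed u hu v hv hd
      have hne : p ≠ u ∧ p ≠ v ∧ q ≠ u ∧ q ≠ v := by
        obtain ⟨k, hk⟩ := hs
        rw [hk.iff] at hcr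
        refine ⟨?_, ?_, ?_, ?_⟩ <;> rintro rfl <;> unfold Cross at hcr <;> omega
      refine noLL p q hpq ?_ ?_
      · by_contra hp
        have := big p (hB.mem _ _ hpq) hp
        tauto
      · by_contra hq
        have := big q (hB.mem_right hpq) hq
        tauto
    constructor
    · apply Finset.Subset.antisymm hE
      intro e
      induction e with | _ p q
      intro hpq
      by_cases hp : Leaf B p
      · exact covered p q hpq hp
      by_cases hq : Leaf B q
      · rw [Sym2.eq_swap] at hpq ⊢
        exact covered q p hpq hq
      exfalso
      apply nodiag
      have hne := hB.ne hs hpq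
      obtain ⟨i, hi, j, hj, hij⟩ := hB.diag _ _ hpq
      rcases big p (hB.mem _ _ hpq) hp with rfl | rfl <;>
        rcases big q (hB.mem_right hpq) hq with rfl | rfl
      · exact absurd rfl hne
      · exact ⟨i, hi, j, hj, hij⟩
      · exact ⟨i, hi, j, hj, hs.swap_left.1 hij⟩
      · exact absurd rfl hne
    · intro u' hu' v' hv' p hp q hq hcr hu'b hv'b _ _
      apply nodiag
      have hne : u' ≠ v' := by
        rintro rfl
        obtain ⟨k, hk⟩ := hs
        rw [hk.iff] at hcr
        unfold Cross at hcr
        omega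
      rcases big u' hu' hu'b with rfl | rfl <;> rcases big v' hv' hv'b with rfl | rfl
      · exact absurd rfl hne
      · exact ⟨p, hp, q, hq, hcr⟩
      · exact ⟨p, hp, q, hq, hs.swap_left.1 hcr⟩
      · exact absurd rfl hne
  · push Not at hbig
    obtain ⟨u, hu, hu'⟩ : ∃ u ∈ S, ∀ v ∈ S, v ≠ u → Leaf B v := by
      by_cases hu : ∃ u ∈ S, ¬ Leaf B u
      · obtain ⟨u, hu, hub⟩ := hu
        exact ⟨u, hu, fun v hv hne => hbig u hu v hv hne.symm hub⟩
      · push Not at hu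
        obtain ⟨u, hu'⟩ : S.Nonempty := Finset.card_pos.1 (by omega)
        exact ⟨u, hu', fun v hv _ => hu v hv⟩
    obtain ⟨z, hz, -, -, hzu, -, hzB, -⟩ := hB.exists_neighbors hs hu
    have hc : ((S.erase u).erase z).card + 2 = S.card := by
      rw [Finset.card_erase_of_mem (Finset.mem_erase.2 ⟨hzu, hz⟩), Finset.card_erase_of_mem hu]
      omega
    have hBc : B.card ≤ ((S.erase u).erase z).card := by
      refine card_le_of_leaf subset_rfl (fun w hw => ?_) fun p q hpq => ?_
      · simp only [Finset.mem_erase] at hw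
        exact hu' w hw.2.2 hw.2.1
      · have hp := hB.mem _ _ hpq
        have hq := hB.mem_right hpq
        have hne := hB.ne hs hpq
        have hpq' : s(q, p) ∈ B := by rwa [Sym2.eq_swap]
        simp only [Finset.mem_erase]
        by_contra! hcon
        by_cases p = z <;> by_cases p = u <;> by_cases q = z <;> by_cases q = u <;> simp_all
    have := Finset.card_le_card hE
    refine ⟨by omega, fun heq => ⟨Finset.eq_of_subset_of_card_le hE (by omega), ?_⟩⟩
    intro u' hu' v' hv' p hp q hq hcr hu'b hv'b _ _
    apply hv'b
    apply hbig u' hu' v' hv' _ hu'b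
    rintro rfl
    obtain ⟨k, hk⟩ := hs
    rw [hk.iff] at hcr
    unfold Cross at hcr
    omega

/-- The braces of the polygon `sideV cr S x y a`, including the cutting pair. -/
noncomputable def sideB (cr : V → V → V → V → Prop) (B : Finset (Sym2 V)) (x y a c : V) :
    Finset (Sym2 V) :=
  insert s(x, y) (insert s(a, c) (sideE cr B x y a))

lemma mem_sideB {e : Sym2 V} : e ∈ sideB cr B x y a c ↔
    e = s(x, y) ∨ e = s(a, c) ∨ e ∈ sideE cr B x y a := by
  simp [sideB]

lemma sideE_subset : sideE cr B x y a ⊆ B := Finset.filter_subset _ _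

lemma sideE_swap (hs : IsSep cr) : sideE cr B y x a = sideE cr B x y a := by
  ext e
  induction e with | _ p q
  rw [mem_sideE, mem_sideE, hs.swap_left, hs.swap_left (b := q)]
  tauto

lemma Cut.swap_ends (hs : IsSep cr) (h : Cut cr S B x y a c) : Cut cr S B x y c a :=
  ⟨h.left, h.right, by rw [Sym2.eq_swap]; exact h.brace, h.priv.symm hs⟩

lemma Cut.swap (hs : IsSep cr) (h : Cut cr S B x y a c) : Cut cr S B y x a c :=
  ⟨h.right, h.left, h.brace, h.priv.swap hs⟩

/-- A numbering of the points adapted to a cut. -/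
structure CutKey (cr : V → V → V → V → Prop) (B : Finset (Sym2 V)) (x y a c : V) (k : V → ℤ) :
    Prop extends IsKey cr k where
  min : ∀ v, k x ≤ k v
  xa : k x < k a
  ay : k a < k y
  yc : k y < k c
  sep : ∀ p q, s(p, q) ∈ B → k x < k p → k p < k y → k y < k q → p = a ∧ q = c

lemma Cut.exists_key [Finite V] (hs : IsSep cr) (h : Cut cr S B x y a c) :
    ∃ k, CutKey cr B x y a c k := by
  obtain ⟨k, hk, h0, h1, h2, h3⟩ := hs.exists_key h.priv.1
  refine ⟨k, hk, h0, h1, h2, h3, fun p q hpq hp hp' hq => ?_⟩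
  have := h.priv.2 p q hpq ((hk.iff _ _ _ _).2 (by unfold Cross; omega))
  rcases Sym2.eq_iff.1 this with h | ⟨rfl, rfl⟩
  · exact h
  · omega

namespace CutKey

variable {k : V → ℤ}

lemma cross_iff (hk : CutKey cr B x y a c k) {v : V} : cr x y a v ↔ k y < k v := by
  rw [hk.iff]
  have := hk.xa; have := hk.ay; have := hk.min v
  unfold Cross; omega

lemma cross_iff' (hk : CutKey cr B x y a c k) {v : V} : cr x y c v ↔ k x < k v ∧ k v < k y := by
  rw [hk.iff]
  have := hk.xa; have := hk.ay; have := hk.yc; have := hk.min v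
  unfold Cross; omega

lemma eq_iff (hk : CutKey cr B x y a c k) {u v : V} : u = v ↔ k u = k v :=
  ⟨fun h => h ▸ rfl, fun h => hk.inj h⟩

lemma closed_iff (hk : CutKey cr B x y a c k) {v : V} :
    (v = x ∨ v = y ∨ cr x y a v) ↔ k v ≤ k x ∨ k y ≤ k v := by
  rw [hk.cross_iff, hk.eq_iff, hk.eq_iff]
  have := hk.xa; have := hk.ay; have := hk.yc; have := hk.min v
  omega

lemma closed_iff' (hk : CutKey cr B x y a c k) {v : V} :
    (v = x ∨ v = y ∨ cr x y c v) ↔ k v ≤ k y := by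
  rw [hk.cross_iff', hk.eq_iff, hk.eq_iff]
  have := hk.xa; have := hk.ay; have := hk.yc; have := hk.min v
  omega

lemma mem_sideV (hk : CutKey cr B x y a c k) {v : V} :
    v ∈ sideV cr S x y a ↔ v ∈ S ∧ (k v = k x ∨ k v = k a ∨ k y ≤ k v) := by
  rw [BracedPolygon.mem_sideV, hk.cross_iff, hk.eq_iff, hk.eq_iff, hk.eq_iff]
  have := hk.xa; have := hk.ay; have := hk.yc; have := hk.min v
  exact and_congr_right fun _ => by omega

lemma mem_sideE {B' : Finset (Sym2 V)} (hk : CutKey cr B x y a c k) {p q : V} :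
    s(p, q) ∈ sideE cr B' x y a ↔
    s(p, q) ∈ B' ∧ (k p ≤ k x ∨ k y ≤ k p) ∧ (k q ≤ k x ∨ k y ≤ k q) := by
  rw [BracedPolygon.mem_sideE, hk.closed_iff, hk.closed_iff]

lemma mem_sideE' {B' : Finset (Sym2 V)} (hk : CutKey cr B x y a c k) {p q : V} :
    s(p, q) ∈ sideE cr B' x y c ↔ s(p, q) ∈ B' ∧ k p ≤ k y ∧ k q ≤ k y := by
  rw [BracedPolygon.mem_sideE, hk.closed_iff', hk.closed_iff']

end CutKey

lemma Cut.card_sideV [Finite V] (hs : IsSep cr) (hB : Braced cr S B) (h : Cut cr S B x y a c) :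
    (sideV cr S x y a).card = (S.filter (cr x y a)).card + 3 := by
  obtain ⟨k, hk⟩ := h.exists_key hs
  have := hk.xa; have := hk.ay; have := hk.yc
  have : sideV cr S x y a = insert x (insert y (insert a (S.filter (cr x y a)))) := by
    ext v
    simp only [BracedPolygon.mem_sideV, Finset.mem_insert, Finset.mem_filter]
    have := h.left; have := h.right; have := hB.mem _ _ h.brace
    by_cases v = x <;> by_cases v = y <;> by_cases v = a <;> simp_all
  rw [this, Finset.card_insert_of_notMem, Finset.card_insert_of_notMem,
    Finset.card_insert_of_notMem]
  all_goals simp only [Finset.mem_insert, Finset.mem_filter, hk.eq_iff, hk.cross_iff]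
  all_goals omega

lemma Cut.card_eq [Finite V] (hs : IsSep cr) (h : Cut cr S B x y a c) :
    S.card = (S.filter (cr x y a)).card + (S.filter (cr x y c)).card + 2 := by
  obtain ⟨k, hk⟩ := h.exists_key hs
  have := hk.xa; have := hk.ay; have := hk.yc
  have hS : S = insert x (insert y (S.filter (cr x y a) ∪ S.filter (cr x y c))) := by
    ext v
    simp only [Finset.mem_union, Finset.mem_insert, Finset.mem_filter]
    have := h.left; have := h.right
    by_cases hx : v = x
    · simp_all
    by_cases hy : v = y
    · simp_all
    simp only [hx, hy, false_or, hk.cross_iff, hk.cross_iff', ← and_or_left]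
    rw [hk.eq_iff] at hx hy
    have := hk.min v
    have : k y < k v ∨ k x < k v ∧ k v < k y := by omega
    tauto
  conv_lhs => rw [hS]
  rw [Finset.card_insert_of_notMem, Finset.card_insert_of_notMem, Finset.card_union_of_disjoint]
  · rw [Finset.disjoint_left]
    simp only [Finset.mem_filter, hk.cross_iff, hk.cross_iff']
    intros; omega
  all_goals
    simp only [Finset.mem_insert, Finset.mem_union, Finset.mem_filter, hk.eq_iff, hk.cross_iff,
      hk.cross_iff']
    omega

lemma Cut.subset_sides [Finite V] (hs : IsSep cr) (h : Cut cr S B x y a c) (hE : E ⊆ B) :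
    E ⊆ insert s(a, c) (sideE cr E x y a ∪ sideE cr E x y c) := by
  obtain ⟨k, hk⟩ := h.exists_key hs
  intro e
  induction e with | _ p q
  intro he
  simp only [Finset.mem_insert, Finset.mem_union, hk.mem_sideE, hk.mem_sideE', he, true_and]
  have h1 := hk.sep p q (hE he)
  have h2 := hk.sep q p (by rw [Sym2.eq_swap]; exact hE he)
  by_contra! hcon
  have hne1 : ¬ (p = a ∧ q = c) := by rintro ⟨rfl, rfl⟩; exact hcon.1 rfl
  have hne2 : ¬ (q = a ∧ p = c) := by rintro ⟨rfl, rfl⟩; exact hcon.1 Sym2.eq_swap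
  have := hk.min p; have := hk.min q; have := hk.xa; have := hk.ay
  by_cases k p ≤ k y <;> by_cases k q ≤ k y <;> simp_all <;> omega

lemma Cut.card_braces_le [Finite V] (hs : IsSep cr) (h : Cut cr S B x y a c) (hE : E ⊆ B) :
    E.card ≤ (sideE cr E x y a).card + (sideE cr E x y c).card + 1 := by
  refine (Finset.card_le_card (h.subset_sides hs hE)).trans ((Finset.card_insert_le _ _).trans ?_)
  have := Finset.card_union_le (sideE cr E x y a) (sideE cr E x y c)
  omega

lemma Cut.braced_side [Finite V] (hs : IsSep cr) (hB : Braced cr S B) (h : Cut cr S B x y a c) :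
    Braced cr (sideV cr S x y a) (sideB cr B x y a c) := by
  obtain ⟨k, hk⟩ := h.exists_key hs
  have hxa := hk.xa; have hay := hk.ay; have hyc := hk.yc
  have ha := hB.mem _ _ h.brace
  have hc := hB.mem_right h.brace
  have hx := h.left; have hy := h.right
  have memx : x ∈ sideV cr S x y a := hk.mem_sideV.2 ⟨hx, .inl rfl⟩
  have memy : y ∈ sideV cr S x y a := hk.mem_sideV.2 ⟨hy, by omega⟩
  have mema : a ∈ sideV cr S x y a := hk.mem_sideV.2 ⟨ha, by omega⟩
  have memc : c ∈ sideV cr S x y a := hk.mem_sideV.2 ⟨hc, by omega⟩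
  refine ⟨?_, ?_, ?_, ?_⟩
  · rw [h.card_sideV hs hB]
    have : 0 < (S.filter (cr x y a)).card :=
      Finset.card_pos.2 ⟨c, by simp [hk.cross_iff, hc, hyc]⟩
    omega
  · intro p q hpq
    rcases mem_sideB.1 hpq with hpq | hpq | hpq
    · rcases Sym2.eq_iff.1 hpq with ⟨rfl, rfl⟩ | ⟨rfl, rfl⟩ <;> assumption
    · rcases Sym2.eq_iff.1 hpq with ⟨rfl, rfl⟩ | ⟨rfl, rfl⟩ <;> assumption
    · rw [hk.mem_sideE] at hpq
      rw [hk.mem_sideV]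
      have := hk.min p
      exact ⟨hB.mem _ _ hpq.1, by omega⟩
  · intro p q hpq
    rcases mem_sideB.1 hpq with hpq | hpq | hpq
    · refine ⟨a, mema, c, memc, ?_⟩
      rw [hk.iff]; unfold Cross
      rcases Sym2.eq_iff.1 hpq with ⟨rfl, rfl⟩ | ⟨rfl, rfl⟩ <;> omega
    · refine ⟨x, memx, y, memy, ?_⟩
      rw [hk.iff]; unfold Cross
      rcases Sym2.eq_iff.1 hpq with ⟨rfl, rfl⟩ | ⟨rfl, rfl⟩ <;> omega
    · rw [hk.mem_sideE] at hpq
      obtain ⟨u, hu, v, hv, huv⟩ := hB.diag _ _ hpq.1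
      rw [hk.iff] at huv
      have := hk.min p; have := hk.min q; have := hk.min u; have := hk.min v
      have huV : u ∈ sideV cr S x y a ∨ k x < k u ∧ k u < k y := by
        rw [hk.mem_sideV]; by_contra! hcon; have := hcon.1 hu; omega
      have hvV : v ∈ sideV cr S x y a ∨ k x < k v ∧ k v < k y := by
        rw [hk.mem_sideV]; by_contra! hcon; have := hcon.1 hv; omega
      rcases huV with huV | huV <;> rcases hvV with hvV | hvV
      · exact ⟨u, huV, v, hvV, (hk.iff _ _ _ _).2 huv⟩
      · refine ⟨u, huV, a, mema, (hk.iff _ _ _ _).2 ?_⟩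
        unfold Cross at huv ⊢; omega
      · refine ⟨a, mema, v, hvV, (hk.iff _ _ _ _).2 ?_⟩
        unfold Cross at huv ⊢; omega
      · unfold Cross at huv; omega
  · rintro z hz w hw ⟨p, hp, q, hq, hpq⟩
    rw [hk.mem_sideV] at hz hw hp hq
    have := hk.min z; have := hk.min w
    by_cases hza : k z = k a ∨ k w = k a
    · refine ⟨x, y, mem_sideB.2 (.inl rfl), ?_⟩
      rw [hk.iff] at hpq ⊢
      unfold Cross at hpq ⊢
      omega
    · obtain ⟨p, q, hpqB, hpq⟩ := hB.crossed z hz.1 w hw.1 ⟨p, hp.1, q, hq.1, hpq⟩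
      refine ⟨p, q, ?_, hpq⟩
      rw [hk.iff] at hpq
      have := hk.min p; have := hk.min q
      rw [mem_sideB]
      by_contra! hcon
      obtain ⟨-, hne, hnE⟩ := hcon
      rw [hk.mem_sideE] at hnE
      have h1 := hk.sep p q hpqB
      have h2 := hk.sep q p (by rwa [Sym2.eq_swap])
      have hne1 : ¬ (p = a ∧ q = c) := by rintro ⟨rfl, rfl⟩; exact hne rfl
      have hne2 : ¬ (q = a ∧ p = c) := by rintro ⟨rfl, rfl⟩; exact hne Sym2.eq_swap
      simp only [hne1, imp_false, hne2, hpqB, true_and] at h1 h2 hnE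
      unfold Cross at hpq; omega

/-- The private pairs of `E` in `B` can be chosen in the closed side of the cut away from `a`. -/
def PrivateSide (cr : V → V → V → V → Prop) (S : Finset V) (B : Finset (Sym2 V))
    (x y a p q : V) : Prop :=
  ∃ z ∈ S, ∃ w ∈ S, (z = x ∨ z = y ∨ cr x y a z) ∧ (w = x ∨ w = y ∨ cr x y a w) ∧
    Private cr B z w p q

lemma Cut.essential_side [Finite V] (hs : IsSep cr) (h : Cut cr S B x y a c)
    {E' : Finset (Sym2 V)} (hE : ∀ p q, s(p, q) ∈ E' → PrivateSide cr S B x y a p q) :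
    Essential cr (sideV cr S x y a) (sideB cr B x y a c) (insert s(a, c) E') := by
  obtain ⟨k, hk⟩ := h.exists_key hs
  have hxa := hk.xa; have hay := hk.ay; have hyc := hk.yc
  intro p q hpq
  rcases Finset.mem_insert.1 hpq with hpq | hpq
  · refine ⟨x, hk.mem_sideV.2 ⟨h.left, .inl rfl⟩, y, hk.mem_sideV.2 ⟨h.right, by omega⟩, ?_, ?_⟩
    · rw [hk.iff]; unfold Cross
      rcases Sym2.eq_iff.1 hpq with ⟨rfl, rfl⟩ | ⟨rfl, rfl⟩ <;> omega
    · intro p' q' hpq' hcr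
      rcases mem_sideB.1 hpq' with hpq' | hpq' | hpq'
      · rw [hk.iff] at hcr; unfold Cross at hcr
        rcases Sym2.eq_iff.1 hpq' with ⟨rfl, rfl⟩ | ⟨rfl, rfl⟩ <;> omega
      · rw [hpq, hpq']
      · rw [hk.iff] at hcr; unfold Cross at hcr
        rw [hk.mem_sideE] at hpq'
        have := hk.min p'; have := hk.min q'
        omega
  · obtain ⟨z, hz, w, hw, hz', hw', hcr, hpriv⟩ := hE p q hpq
    refine ⟨z, mem_sideV.2 ⟨hz, by tauto⟩, w, mem_sideV.2 ⟨hw, by tauto⟩, hcr, ?_⟩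
    intro p' q' hpq' hcr'
    rcases mem_sideB.1 hpq' with hpq' | hpq' | hpq'
    · rw [hk.closed_iff] at hz' hw'
      rw [hk.iff] at hcr'; unfold Cross at hcr'
      have := hk.min z; have := hk.min w
      rcases Sym2.eq_iff.1 hpq' with ⟨rfl, rfl⟩ | ⟨rfl, rfl⟩ <;> omega
    · exact hpriv p' q' (hpq' ▸ h.brace) hcr'
    · exact hpriv p' q' (sideE_subset hpq') hcr'

lemma CutKey.sep_symm {k : V → ℤ} (hk : CutKey cr B x y a c k) {p q : V} (h : s(p, q) ∈ B)
    (hq : k x < k q) (hq' : k q < k y) (hp : k y < k p) : q = a ∧ p = c :=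
  hk.sep q p (by rwa [Sym2.eq_swap]) hq hq' hp

lemma CutKey.reflect [Finite V] {k : V → ℤ} (hk : CutKey cr B x y a c k) :
    ∃ k', CutKey cr B y x a c k' ∧ (∀ u v, k u ≤ k y → k v ≤ k y → (k' u ≤ k' v ↔ k v ≤ k u)) ∧
      (∀ u v, k y < k u → k y < k v → (k' u ≤ k' v ↔ k v ≤ k u)) ∧
      ∀ u v, k u ≤ k y → k y < k v → k' u < k' v := by
  obtain ⟨M, hM⟩ := (Set.finite_range k).bddAbove
  have hM' : ∀ v, k v ≤ M := fun v => hM ⟨v, rfl⟩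
  have hm := hk.min; have hxa := hk.xa; have hay := hk.ay; have hyc := hk.yc
  refine ⟨fun v => if k v ≤ k y then - k v else - k v + (M - k x + 1), ?_, ?_, ?_, ?_⟩
  · refine ⟨⟨?_, ?_⟩, ?_, ?_, ?_, ?_, ?_⟩
    · intro u v huv
      apply hk.inj
      have := hM' u; have := hM' v; have := hm u; have := hm v
      simp only at huv
      split_ifs at huv <;> omega
    · intro u v p q
      rw [hk.iff]
      have := hM' u; have := hM' v; have := hm u; have := hm v
      have := hM' p; have := hM' q; have := hm p; have := hm q
      unfold Cross
      split_ifs <;> omega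
    · intro v
      have := hM' v; have := hm v
      simp only [le_refl, if_true]
      split_ifs <;> omega
    · split_ifs <;> omega
    · split_ifs <;> omega
    · have := hM' c
      split_ifs <;> omega
    · intro p q hpq
      have := hM' p; have := hm p; have := hM' q; have := hm q
      have := hk.sep p q hpq
      split_ifs <;> intros <;> first | omega | exact this (by omega) (by omega) (by omega)
  all_goals
    intro u v hu hv
    have := hM' u; have := hM' v; have := hm u; have := hm v
    simp only; split_ifs <;> omega

lemma Cut.exists_ne_of_not_leaf [Finite V] (hs : IsSep cr) (hB : Braced cr S B)
    (h : Cut cr S B x y a c) (ha : ¬ Leaf B a) : ∃ v ∈ S, cr x y c v ∧ v ≠ a := by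
  obtain ⟨k, hk⟩ := h.exists_key hs
  have hxa := hk.xa; have hay := hk.ay; have hyc := hk.yc
  by_contra! hcon
  simp only [hk.cross_iff', hk.eq_iff] at hcon
  refine ha fun w w' hw hw' => ?_
  have key : ∀ w, s(a, w) ∈ B → w = c := by
    intro w hw
    have := hk.min w
    by_cases hyw : k y < k w
    · exact (hk.sep a w hw hxa hay hyw).2
    · exfalso
      obtain ⟨u, hu, v, hv, huv⟩ := hB.diag _ _ hw
      have hne := hB.ne hs hw
      have h1 := hcon u hu; have h2 := hcon v hv; have h3 := hcon w (hB.mem_right hw)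
      rw [Ne, hk.eq_iff] at hne
      rw [hk.iff] at huv
      unfold Cross at huv
      have := hk.min u; have := hk.min v
      omega
  rw [key w hw, key w' hw']

lemma Cut.two_le_card [Finite V] (hs : IsSep cr) (hB : Braced cr S B)
    (h : Cut cr S B x y a c) (ha : ¬ Leaf B a) : 2 ≤ (S.filter (cr x y c)).card := by
  obtain ⟨v, hv, hcv, hva⟩ := h.exists_ne_of_not_leaf hs hB ha
  obtain ⟨k, hk⟩ := h.exists_key hs
  rw [← Finset.card_pair hva]
  refine Finset.card_le_card fun u hu => ?_
  rw [Finset.mem_insert, Finset.mem_singleton] at hu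
  rcases hu with rfl | rfl
  · exact Finset.mem_filter.2 ⟨hv, hcv⟩
  · exact Finset.mem_filter.2 ⟨hB.mem _ _ h.brace, hk.cross_iff'.2 ⟨hk.xa, hk.ay⟩⟩

lemma Cut.card_sideV_lt [Finite V] (hs : IsSep cr) (hB : Braced cr S B)
    (h : Cut cr S B x y a c) (ha : ¬ Leaf B a) : (sideV cr S x y a).card < S.card := by
  have := h.two_le_card hs hB ha
  rw [h.card_sideV hs hB, h.card_eq hs]
  omega

/-- If the pair `x`, `y` cuts off as few points as possible together with `a`, then the braces
on the other side have private pairs on that side. -/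
lemma Cut.privateSide_of_min [Finite V] (hs : IsSep cr) (hB : Braced cr S B)
    (h : Cut cr S B x y a c) (ha : ¬ Leaf B a)
    (hmin : ∀ x' y', Cut cr S B x' y' a c →
      (S.filter (cr x y c)).card ≤ (S.filter (cr x' y' c)).card)
    (hEs : Essential cr S B E) {p q : V} (hpq : s(p, q) ∈ sideE cr E x y a) :
    PrivateSide cr S B x y a p q := by
  obtain ⟨k, hk⟩ := h.exists_key hs
  have hxa := hk.xa; have hay := hk.ay; have hyc := hk.yc
  have haS := hB.mem _ _ h.brace
  rw [hk.mem_sideE] at hpq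
  obtain ⟨hpqE, hp, hq⟩ := hpq
  obtain ⟨z, hz, w, hw, hP⟩ := hEs p q hpqE
  wlog hzw : k z ≤ k w generalizing z w
  · exact this w hw z hz (hP.swap hs) (by omega)
  have hcr := (hk.iff _ _ _ _).1 hP.1
  have := hk.min p; have := hk.min q; have := hk.min z; have := hk.min w
  by_cases hcl : (k z ≤ k x ∨ k y ≤ k z) ∧ (k w ≤ k x ∨ k y ≤ k w)
  · exact ⟨z, hz, w, hw, hk.closed_iff.2 hcl.1, hk.closed_iff.2 hcl.2, hP⟩
  exfalso
  have hz1 : k x < k z := by unfold Cross at hcr; omega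
  have hz2 : k z < k y := by unfold Cross at hcr; omega
  have hw1 : k y < k w := by unfold Cross at hcr; omega
  have hno : ∀ i j, s(i, j) ∈ B → Cross (k z) (k w) (k i) (k j) →
      (k i ≤ k x ∨ k y ≤ k i) ∧ (k j ≤ k x ∨ k y ≤ k j) := by
    intro i j hij hcr
    rcases Sym2.eq_iff.1 (hP.2 i j hij ((hk.iff _ _ _ _).2 hcr)) with ⟨rfl, rfl⟩ | ⟨rfl, rfl⟩
    · exact ⟨hp, hq⟩
    · exact ⟨hq, hp⟩
  have hxz : ∀ i j, s(i, j) ∈ B → cr x z i j → s(i, j) = s(a, c) := by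
    intro i j hij hcr
    rw [hk.iff] at hcr
    have h1 := hk.sep i j hij
    have h2 := hk.sep_symm hij
    have h3 := hno i j hij
    have := hk.min i; have := hk.min j
    unfold Cross at hcr h3
    have : (k x < k i ∧ k i < k y ∧ k y < k j) ∨ (k x < k j ∧ k j < k y ∧ k y < k i) := by omega
    rcases this with ⟨u1, u2, u3⟩ | ⟨u1, u2, u3⟩
    · rw [(h1 u1 u2 u3).1, (h1 u1 u2 u3).2]
    · rw [(h2 u1 u2 u3).1, (h2 u1 u2 u3).2, Sym2.eq_swap]
  have hzy : ∀ i j, s(i, j) ∈ B → cr z y i j → s(i, j) = s(a, c) := by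
    intro i j hij hcr
    rw [hk.iff] at hcr
    have h1 := hk.sep i j hij
    have h2 := hk.sep_symm hij
    have h3 := hno i j hij
    have := hk.min i; have := hk.min j
    unfold Cross at hcr h3
    have : (k x < k i ∧ k i < k y ∧ k y < k j) ∨ (k x < k j ∧ k j < k y ∧ k y < k i) := by omega
    rcases this with ⟨u1, u2, u3⟩ | ⟨u1, u2, u3⟩
    · rw [(h1 u1 u2 u3).1, (h1 u1 u2 u3).2]
    · rw [(h2 u1 u2 u3).1, (h2 u1 u2 u3).2, Sym2.eq_swap]
  have smaller : ∀ x' y', Cut cr S B x' y' a c → (∀ v, cr x' y' c v → cr x y c v) →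
      ¬ cr x' y' c z → False := by
    intro x' y' hcut hsub hz'
    refine (hmin x' y' hcut).not_gt (Finset.card_lt_card ?_)
    rw [Finset.ssubset_iff_of_subset
      (fun v hv => by rw [Finset.mem_filter] at hv ⊢; exact ⟨hv.1, hsub v hv.2⟩)]
    exact ⟨z, Finset.mem_filter.2 ⟨hz, hk.cross_iff'.2 ⟨hz1, hz2⟩⟩, fun hmem =>
      hz' (Finset.mem_filter.1 hmem).2⟩
  rcases lt_trichotomy (k a) (k z) with haz | haz | haz
  · refine smaller x z ⟨h.left, hz, h.brace, ?_, hxz⟩ ?_ ?_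
    · rw [hk.iff]; unfold Cross; omega
    · intro v hv
      rw [hk.iff] at hv ⊢; unfold Cross at hv ⊢; omega
    · rw [hk.iff]; unfold Cross; omega
  · obtain rfl := hk.inj haz
    obtain ⟨v, hv, hcv, hva⟩ := h.exists_ne_of_not_leaf hs hB ha
    rw [hk.cross_iff'] at hcv
    rw [Ne, hk.eq_iff] at hva
    rcases lt_or_gt_of_ne hva with hlt | hlt
    · obtain ⟨i, j, hij, hcr⟩ := hB.crossed x h.left a haS
        ⟨v, hv, y, h.right, by rw [hk.iff]; unfold Cross; omega⟩
      have := hxz i j hij hcr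
      rw [hk.iff] at hcr; unfold Cross at hcr
      rcases Sym2.eq_iff.1 this with ⟨rfl, rfl⟩ | ⟨rfl, rfl⟩ <;> omega
    · obtain ⟨i, j, hij, hcr⟩ := hB.crossed a haS y h.right
        ⟨v, hv, x, h.left, by rw [hk.iff]; unfold Cross; omega⟩
      have := hzy i j hij hcr
      rw [hk.iff] at hcr; unfold Cross at hcr
      rcases Sym2.eq_iff.1 this with ⟨rfl, rfl⟩ | ⟨rfl, rfl⟩ <;> omega
  · refine smaller z y ⟨hz, h.right, h.brace, ?_, hzy⟩ ?_ ?_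
    · rw [hk.iff]; unfold Cross; omega
    · intro v hv
      rw [hk.iff] at hv ⊢; unfold Cross at hv ⊢; omega
    · rw [hk.iff]; unfold Cross; omega

lemma Cut.not_privateSide_self [Finite V] (hs : IsSep cr) (h : Cut cr S B x y a c) :
    ¬ PrivateSide cr S B x y a x y := by
  obtain ⟨k, hk⟩ := h.exists_key hs
  rintro ⟨z, -, w, -, hz, hw, hP⟩
  have hcr := hP.1
  rw [hk.closed_iff] at hz hw
  rw [hk.iff] at hcr; unfold Cross at hcr
  have := hk.min z; have := hk.min w; have := hk.xa; have := hk.ay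
  omega

lemma Cut.notMem_sideE [Finite V] (hs : IsSep cr) (h : Cut cr S B x y a c) :
    s(a, c) ∉ sideE cr E x y a := by
  obtain ⟨k, hk⟩ := h.exists_key hs
  rw [hk.mem_sideE]
  have := hk.xa; have := hk.ay
  omega

lemma Cut.ne_pair [Finite V] (hs : IsSep cr) (h : Cut cr S B x y a c) : s(x, y) ≠ s(a, c) := by
  obtain ⟨k, hk⟩ := h.exists_key hs
  intro heq
  have := hk.xa; have := hk.ay
  rcases Sym2.eq_iff.1 heq with ⟨rfl, rfl⟩ | ⟨rfl, rfl⟩ <;> omega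

/-- The bound for all polygons with less than `n` points. -/
def BoundBelow (cr : V → V → V → V → Prop) (n : ℕ) : Prop :=
  ∀ (S : Finset V) (B E : Finset (Sym2 V)), S.card < n → Braced cr S B → E ⊆ B →
    Essential cr S B E → EssentialBound cr S B E

lemma sideE_mono (hE : E ⊆ B) : sideE cr E x y a ⊆ sideE cr B x y a :=
  Finset.filter_subset_filter _ hE

lemma Cut.card_sideE_lt [Finite V] (hs : IsSep cr) (hB : Braced cr S B)
    (h : Cut cr S B x y a c) (ih : BoundBelow cr S.card) (ha : ¬ Leaf B a) (hE : E ⊆ B)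
    (hxy : s(x, y) ∉ E)
    (hpriv : ∀ p q, s(p, q) ∈ sideE cr E x y a → PrivateSide cr S B x y a p q) :
    (sideE cr E x y a).card + 1 ≤ (S.filter (cr x y a)).card := by
  have hb := ih _ _ _ (h.card_sideV_lt hs hB ha) (h.braced_side hs hB)
    ((Finset.insert_subset_insert _ (sideE_mono hE)).trans (Finset.subset_insert _ _))
    (h.essential_side hs hpriv)
  rw [EssentialBound, h.card_sideV hs hB, Finset.card_insert_of_notMem (h.notMem_sideE hs)] at hb
  have : (sideE cr E x y a).card + 1 + 2 ≠ (S.filter (cr x y a)).card + 3 := by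
    intro heq
    have hmem : s(x, y) ∈ sideB cr B x y a c := Finset.mem_insert_self _ _
    rw [← (hb.2 heq).1, Finset.mem_insert] at hmem
    rcases hmem with hmem | hmem
    · exact h.ne_pair hs hmem
    · exact hxy (sideE_subset hmem)
  omega

lemma CutKey.privateSide_or_leaf [Finite V] (hs : IsSep cr) (hB : Braced cr S B)
    (h : Cut cr S B x y a c) {k : V → ℤ} (hk : CutKey cr B x y a c k) (hc : ¬ Leaf B c) {p q z w : V}
    (hpq : s(p, q) ∈ sideE cr B x y c) (hxy : s(p, q) ≠ s(x, y)) (hz : z ∈ S) (hw : w ∈ S)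
    (hP : Private cr B z w p q) (hz1 : k x < k z) (hz2 : k z < k y) (hw1 : k y < k w)
    (haz : k a ≤ k z) (hcw : k w ≤ k c) :
    PrivateSide cr S B x y c p q ∨ Leaf B y ∧ ∃ b, cr x y c b ∧ s(p, q) = s(y, b) := by
  have hxa := hk.xa; have hay := hk.ay; have hyc := hk.yc
  rw [hk.mem_sideE'] at hpq
  obtain ⟨hpqB, hp, hq⟩ := hpq
  have hxS := h.left; have hyS := h.right
  have hno : ∀ i j, s(i, j) ∈ B → Cross (k z) (k w) (k i) (k j) → k i ≤ k y ∧ k j ≤ k y := by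
    intro i j hij hcr
    rcases Sym2.eq_iff.1 (hP.2 i j hij ((hk.iff _ _ _ _).2 hcr)) with ⟨rfl, rfl⟩ | ⟨rfl, rfl⟩
    · exact ⟨hp, hq⟩
    · exact ⟨hq, hp⟩
  have hsep : ∀ i j, s(i, j) ∈ B → k x < k i → k i < k y → k y < k j → k i = k a ∧ k j = k c :=
    fun i j hij h1 h2 h3 => by rw [(hk.sep i j hij h1 h2 h3).1, (hk.sep i j hij h1 h2 h3).2]; simp
  have hsep' : ∀ i j, s(i, j) ∈ B → k x < k j → k j < k y → k y < k i → k j = k a ∧ k i = k c :=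
    fun i j hij => hsep j i (by rwa [Sym2.eq_swap])
  have gap : ∀ v ∈ S, ¬ (k y < k v ∧ k v < k w) := by
    intro v hv hlt
    obtain ⟨i, j, hij, hcr⟩ := hB.crossed y hyS w hw
      ⟨v, hv, x, hxS, by rw [hk.iff]; unfold Cross; omega⟩
    rw [hk.iff] at hcr
    have h1 := hsep i j hij; have h2 := hsep' i j hij; have h3 := hno i j hij
    have := hk.min i; have := hk.min j
    unfold Cross at hcr h3
    omega
  have hwc : k w < k c := by
    by_contra hwc
    obtain ⟨v, hv, hcv, hvc⟩ := (h.swap_ends hs).exists_ne_of_not_leaf hs hB hc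
    rw [hk.cross_iff] at hcv
    rw [Ne, hk.eq_iff] at hvc
    have hvw : k w < k v := by have := gap v hv; omega
    obtain ⟨i, j, hij, hcr⟩ := hB.crossed x hxS w hw
      ⟨y, hyS, v, hv, by rw [hk.iff]; unfold Cross; omega⟩
    rw [hk.iff] at hcr
    have h1 := hsep i j hij; have h2 := hsep' i j hij; have h3 := hno i j hij
    have := hk.min i; have := hk.min j
    unfold Cross at hcr h3
    omega
  by_cases hv : ∃ v ∈ S, k z < k v ∧ k v < k y
  · left
    obtain ⟨v, hv, hzv, hvy⟩ := hv
    have hall : ∀ i j, s(i, j) ∈ B → cr z y i j → s(i, j) = s(p, q) := by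
      intro i j hij hcr
      refine hP.2 i j hij ?_
      rw [hk.iff] at hcr ⊢
      have h1 := hsep i j hij; have h2 := hsep' i j hij
      have := hk.min i; have := hk.min j
      unfold Cross at hcr ⊢
      omega
    obtain ⟨i, j, hij, hcr⟩ := hB.crossed z hz y hyS
      ⟨v, hv, x, hxS, by rw [hk.iff]; unfold Cross; omega⟩
    refine ⟨z, hz, y, hyS, hk.closed_iff'.2 hz2.le, hk.closed_iff'.2 le_rfl, ?_, hall⟩
    rcases Sym2.eq_iff.1 (hall i j hij hcr) with ⟨rfl, rfl⟩ | ⟨rfl, rfl⟩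
    · exact hcr
    · exact hs.swap_right.1 hcr
  · right
    push Not at hv
    have main : ∀ q, s(y, q) ∈ B → Private cr B z w y q → k q ≤ k y → y ≠ q → q ≠ x →
        Leaf B y ∧ cr x y c q := by
      intro q hpqB hP hq hyq hqx
      have hcr := hP.1
      rw [hk.iff] at hcr
      rw [Ne, hk.eq_iff] at hqx
      have key : ∀ v, s(y, v) ∈ B → v = q := by
        intro v hyv
        by_cases hcv : cr z w y v
        · exact (Sym2.congr_right).1 (hP.2 y v hyv hcv)
        exfalso
        rw [hk.iff] at hcv
        have hvS := hB.mem_right hyv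
        obtain ⟨i, hi, j, hj, hij⟩ := hB.diag _ _ hyv
        rw [hk.iff] at hij
        have hne := hB.ne hs hyv
        rw [Ne, hk.eq_iff] at hne
        have := hv v hvS; have := hv i hi; have := hv j hj
        have := gap v hvS; have := gap i hi; have := gap j hj
        unfold Cross at hcv hij
        omega
      refine ⟨fun v v' h1 h2 => (key v h1).trans (key v' h2).symm, ?_⟩
      rw [Ne, hk.eq_iff] at hyq
      have := hk.min q
      rw [hk.cross_iff']
      omega
    have hcr := hP.1
    have hne := hB.ne hs hpqB
    rw [hk.iff] at hcr
    have h1 := hv p (hB.mem _ _ hpqB); have h2 := hv q (hB.mem_right hpqB)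
    have h3 : k p = k y ∨ k q = k y := by unfold Cross at hcr; omega
    rcases h3 with h3 | h3
    · obtain rfl := hk.inj h3
      obtain ⟨h4, h5⟩ := main q hpqB hP hq hne (by rintro rfl; exact hxy Sym2.eq_swap)
      exact ⟨h4, q, h5, rfl⟩
    · obtain rfl := hk.inj h3
      obtain ⟨h4, h5⟩ := main p (by rwa [Sym2.eq_swap]) (hP.symm hs) hp hne.symm
        (by rintro rfl; exact hxy rfl)
      exact ⟨h4, p, h5, Sym2.eq_swap⟩

/-- A brace on the side of `a` has a private pair on that side, or is the only brace at one of
the cutting points. -/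
lemma Cut.privateSide_or_leaf [Finite V] (hs : IsSep cr) (hB : Braced cr S B)
    (h : Cut cr S B x y a c) (hc : ¬ Leaf B c) (hE : E ⊆ B) (hEs : Essential cr S B E) {p q : V}
    (hpq : s(p, q) ∈ sideE cr E x y c) (hxy : s(p, q) ≠ s(x, y)) :
    PrivateSide cr S B x y c p q ∨ (Leaf B y ∧ ∃ b, cr x y c b ∧ s(p, q) = s(y, b)) ∨
      Leaf B x ∧ ∃ b, cr x y c b ∧ s(p, q) = s(x, b) := by
  obtain ⟨k, hk⟩ := h.exists_key hs
  have hxa := hk.xa; have hay := hk.ay; have hyc := hk.yc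
  have hpqB := sideE_mono hE hpq
  have hpqk := hk.mem_sideE'.1 hpq
  obtain ⟨z, hz, w, hw, hP⟩ := hEs p q (sideE_subset hpq)
  wlog hzw : k z ≤ k w generalizing z w
  · exact this w hw z hz (hP.swap hs) (by omega)
  have hcr := (hk.iff _ _ _ _).1 hP.1
  have := hk.min p; have := hk.min q; have := hk.min z; have := hk.min w
  by_cases hcl : k w ≤ k y
  · exact .inl ⟨z, hz, w, hw, hk.closed_iff'.2 (by omega), hk.closed_iff'.2 hcl, hP⟩
  have hz1 : k x < k z := by unfold Cross at hcr; omega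
  have hz2 : k z < k y := by unfold Cross at hcr; omega
  have hac : ¬ Cross (k z) (k w) (k a) (k c) := by
    intro hac
    rcases Sym2.eq_iff.1 (hP.2 a c h.brace ((hk.iff _ _ _ _).2 hac)) with ⟨rfl, rfl⟩ | ⟨rfl, rfl⟩ <;>
      omega
  have : (k a ≤ k z ∧ k w ≤ k c) ∨ (k z ≤ k a ∧ k c ≤ k w) := by unfold Cross at hac; omega
  rcases this with hca | hca
  · have := hk.privateSide_or_leaf hs hB h hc hpqB hxy hz hw hP hz1 hz2 (by omega) hca.1 hca.2
    exact this.imp_right .inl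
  · obtain ⟨k', hk', h1, h2, h3⟩ := hk.reflect
    have g1 := h1 z y (by omega) (by omega); have g2 := h1 x z (by omega) (by omega)
    have g4 := h3 x w (by omega) (by omega); have g5 := h1 a z (by omega) (by omega)
    have g6 := h2 w c (by omega) (by omega)
    have := hk'.privateSide_or_leaf hs hB (h.swap hs) hc (by rwa [sideE_swap hs])
      (by rwa [Sym2.eq_swap (a := y)]) hz hw hP (by omega) (by omega) (by omega) (by omega) (by omega)
    rcases this with ⟨z, hz, w, hw, hz', hw', hP⟩ | ⟨hx, b, hb, hpqb⟩
    · rw [← hs.swap_left, or_left_comm] at hz' hw'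
      exact .inl ⟨z, hz, w, hw, hz', hw', hP⟩
    · exact .inr (.inr ⟨hx, b, hs.swap_left.1 hb, hpqb⟩)

lemma Braced.mono (hB : Braced cr S B) {B' : Finset (Sym2 V)} (hsub : B' ⊆ B)
    (hcr : Crossed cr S B') : Braced cr S B' :=
  ⟨hB.card, fun p q h => hB.mem p q (hsub h), fun p q h => hB.diag p q (hsub h), hcr⟩

lemma Braced.exists_private_of_not_crossed (hs : IsSep cr) {B' : Finset (Sym2 V)} {p q : V}
    (hB : Braced cr S B) (hsub : ∀ f ∈ B, f = s(p, q) ∨ f ∈ B') (hcr : ¬ Crossed cr S B') :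
    ∃ z ∈ S, ∃ w ∈ S, Private cr B z w p q := by
  unfold Crossed at hcr
  push Not at hcr
  obtain ⟨z, hz, w, hw, hzw, hno⟩ := hcr
  obtain ⟨i, j, hij, hijc⟩ := hB.crossed z hz w hw hzw
  have hall : ∀ i j, s(i, j) ∈ B → cr z w i j → s(i, j) = s(p, q) := fun i j hij hc =>
    (hsub _ hij).resolve_right fun hmem => hno i j hmem hc
  refine ⟨z, hz, w, hw, ?_, hall⟩
  rcases Sym2.eq_iff.1 (hall i j hij hijc) with ⟨rfl, rfl⟩ | ⟨rfl, rfl⟩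
  · exact hijc
  · exact hs.swap_right.1 hijc

/-- A cut for which the brace `s(y, b)` at the leaf `y` has no private pair on the side of `a`. -/
structure StuckCut (cr : V → V → V → V → Prop) (S : Finset V) (B E : Finset (Sym2 V))
    (x y a c b : V) : Prop extends Cut cr S B x y a c where
  big_a : ¬ Leaf B a
  big_c : ¬ Leaf B c
  sub : E ⊆ B
  ess : Essential cr S B E
  leaf : Leaf B y
  mem : s(y, b) ∈ E
  near : cr x y c b
  stuck : ¬ PrivateSide cr S B x y c y b

namespace StuckCut

variable {b : V}

lemma eq_of_brace (h : StuckCut cr S B E x y a c b) {v : V} (hv : s(y, v) ∈ B) : v = b :=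
  h.leaf v b hv (h.sub h.mem)

lemma notMem [Finite V] (hs : IsSep cr) (h : StuckCut cr S B E x y a c b) : s(x, y) ∉ B := by
  obtain ⟨k, hk⟩ := h.exists_key hs
  intro hxy
  obtain rfl := h.eq_of_brace (by rwa [Sym2.eq_swap] : s(y, x) ∈ B)
  have := hk.cross_iff'.1 h.near
  omega

lemma subset (h : StuckCut cr S B E x y a c b) : insert s(c, a) (sideE cr B x y c) ⊆ B :=
  Finset.insert_subset (by rw [Sym2.eq_swap]; exact h.brace) sideE_subset

lemma braced_near [Finite V] (hs : IsSep cr) (hB : Braced cr S B)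
    (h : StuckCut cr S B E x y a c b)
    (hcr : Crossed cr (sideV cr S x y c) (insert s(c, a) (sideE cr B x y c))) :
    Braced cr (sideV cr S x y c) (insert s(c, a) (sideE cr B x y c)) :=
  ((h.toCut.swap_ends hs).braced_side hs hB).mono (Finset.subset_insert _ _) hcr

lemma privateSide_or_leaf [Finite V] (hs : IsSep cr) (hB : Braced cr S B)
    (h : StuckCut cr S B E x y a c b) {p q : V} (hpq : s(p, q) ∈ sideE cr E x y c) :
    PrivateSide cr S B x y c p q ∨ s(p, q) = s(y, b) ∨
      Leaf B x ∧ ∃ b', cr x y c b' ∧ s(p, q) = s(x, b') := by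
  have hxy : s(p, q) ≠ s(x, y) := fun heq =>
    h.notMem hs (heq ▸ h.sub (sideE_subset hpq))
  rcases h.toCut.privateSide_or_leaf hs hB h.big_c h.sub h.ess hpq hxy with
    h1 | ⟨-, b', -, hb'⟩ | h1
  · exact .inl h1
  · refine .inr (.inl ?_)
    rw [hb', h.eq_of_brace (v := b') (hb' ▸ h.sub (sideE_subset hpq))]
  · exact .inr (.inr h1)

lemma essential_near [Finite V] (hs : IsSep cr) (hB : Braced cr S B)
    (h : StuckCut cr S B E x y a c b)
    (hcr : Crossed cr (sideV cr S x y c) (insert s(c, a) (sideE cr B x y c))) :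
    Essential cr (sideV cr S x y c) (insert s(c, a) (sideE cr B x y c))
      (insert s(c, a) (sideE cr E x y c)) := by
  have hB1 := h.braced_near hs hB hcr
  have hmono : ∀ E', (∀ p q, s(p, q) ∈ E' → PrivateSide cr S B x y c p q) →
      Essential cr (sideV cr S x y c) (insert s(c, a) (sideE cr B x y c)) (insert s(c, a) E') := by
    intro E' hE' p q hpq
    obtain ⟨z, hz, w, hw, hP⟩ := (h.toCut.swap_ends hs).essential_side hs hE' p q hpq
    exact ⟨z, hz, w, hw, hP.mono (Finset.subset_insert _ _)⟩
  intro p q hpq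
  rcases Finset.mem_insert.1 hpq with heq | hpq
  · exact hmono ∅ (by simp) p q (heq ▸ Finset.mem_insert_self _ _)
  have hmem : s(p, q) ∈ insert s(c, a) (sideE cr B x y c) :=
    Finset.mem_insert_of_mem (sideE_mono h.sub hpq)
  have hleaf : ∀ u v, Leaf B u → s(p, q) = s(u, v) → ∃ z ∈ sideV cr S x y c,
      ∃ w ∈ sideV cr S x y c, Private cr (insert s(c, a) (sideE cr B x y c)) z w p q := by
    intro u v hu heq
    obtain ⟨z, hz, w, hw, hP⟩ := hB1.private_of_leaf hs (hu.mono h.subset) (heq ▸ hmem)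
    rcases Sym2.eq_iff.1 heq with ⟨rfl, rfl⟩ | ⟨rfl, rfl⟩
    · exact ⟨z, hz, w, hw, hP⟩
    · exact ⟨z, hz, w, hw, hP.symm hs⟩
  rcases h.privateSide_or_leaf hs hB hpq with h1 | h1 | ⟨hx, b', -, h1⟩
  · refine hmono {s(p, q)} (fun p' q' h' => ?_) p q (by simp)
    rw [Finset.mem_singleton] at h'
    rcases Sym2.eq_iff.1 h' with ⟨rfl, rfl⟩ | ⟨rfl, rfl⟩
    · exact h1
    · obtain ⟨z, hz, w, hw, hz', hw', hP⟩ := h1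
      exact ⟨z, hz, w, hw, hz', hw', hP.symm hs⟩
  · exact hleaf y b h.leaf h1
  · exact hleaf x b' hx h1

lemma card_near [Finite V] (hs : IsSep cr) (h : StuckCut cr S B E x y a c b) :
    (insert s(c, a) (sideE cr E x y c)).card = (sideE cr E x y c).card + 1 :=
  Finset.card_insert_of_notMem ((h.toCut.swap_ends hs).notMem_sideE hs)

lemma bound_near [Finite V] (hs : IsSep cr) (hB : Braced cr S B)
    (ih : BoundBelow cr S.card) (h : StuckCut cr S B E x y a c b)
    (hcr : Crossed cr (sideV cr S x y c) (insert s(c, a) (sideE cr B x y c))) :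
    EssentialBound cr (sideV cr S x y c) (insert s(c, a) (sideE cr B x y c))
      (insert s(c, a) (sideE cr E x y c)) :=
  ih _ _ _ ((h.toCut.swap_ends hs).card_sideV_lt hs hB h.big_c) (h.braced_near hs hB hcr)
    (Finset.insert_subset_insert _ (sideE_mono h.sub)) (h.essential_near hs hB hcr)

lemma mem_near (h : StuckCut cr S B E x y a c b) :
    s(y, b) ∈ sideE cr E x y c := by
  rw [mem_sideE]
  exact ⟨h.mem, .inr (.inl rfl), .inr (.inr h.near)⟩

/-- The bounds when the side of `a` is not braced without the cutting pair. -/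
lemma card_of_not_crossed [Finite V] (hs : IsSep cr) (hB : Braced cr S B)
    (ih : BoundBelow cr S.card) (h : StuckCut cr S B E x y a c b)
    (hcr : ¬ Crossed cr (sideV cr S x y c) (insert s(c, a) (sideE cr B x y c))) :
    (sideE cr E x y c).card ≤ (S.filter (cr x y c)).card ∧
      ((∃ d, s(x, d) ∈ B ∧ cr x y a d) →
        (sideE cr E x y c).card + 1 ≤ (S.filter (cr x y c)).card) := by
  have hcut := h.toCut.swap_ends hs
  have hB' := hcut.braced_side hs hB
  set G := (sideE cr E x y c).filter fun f => ∀ p q, f = s(p, q) → PrivateSide cr S B x y c p q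
    with hG
  have hGE : G ⊆ sideE cr E x y c := Finset.filter_subset _ _
  have hGs : ∀ p q, s(p, q) ∈ G → PrivateSide cr S B x y c p q := fun p q hpq =>
    (Finset.mem_filter.1 hpq).2 p q rfl
  have hmemG : ∀ p q, s(p, q) ∈ sideE cr E x y c → PrivateSide cr S B x y c p q →
      s(p, q) ∈ G := by
    intro p q hpq hP
    refine Finset.mem_filter.2 ⟨hpq, fun p' q' heq => ?_⟩
    rcases Sym2.eq_iff.1 heq with ⟨rfl, rfl⟩ | ⟨rfl, rfl⟩
    · exact hP
    · obtain ⟨z, hz, w, hw, hz', hw', hP⟩ := hP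
      exact ⟨z, hz, w, hw, hz', hw', hP.symm hs⟩
  have hxy : s(x, y) ∉ insert s(c, a) G := by
    rw [Finset.mem_insert, not_or]
    exact ⟨hcut.ne_pair hs, fun hmem => h.notMem hs (h.sub (sideE_subset (hGE hmem)))⟩
  have hca : s(c, a) ∉ G := fun hmem => hcut.notMem_sideE hs (hGE hmem)
  have hess : Essential cr (sideV cr S x y c) (sideB cr B x y c a)
      (insert s(x, y) (insert s(c, a) G)) := by
    intro p q hpq
    rcases Finset.mem_insert.1 hpq with heq | hpq
    · obtain ⟨z, hz, w, hw, hP⟩ := hB'.exists_private_of_not_crossed (p := x) (q := y) hs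
        (fun f hf => Finset.mem_insert.1 hf) hcr
      rcases Sym2.eq_iff.1 heq with ⟨rfl, rfl⟩ | ⟨rfl, rfl⟩
      · exact ⟨z, hz, w, hw, hP⟩
      · exact ⟨z, hz, w, hw, hP.symm hs⟩
    · exact hcut.essential_side hs hGs p q hpq
  have hb := ih _ _ _ (hcut.card_sideV_lt hs hB h.big_c) hB'
    (Finset.insert_subset_insert _
      (Finset.insert_subset_insert _ (hGE.trans (sideE_mono h.sub)))) hess
  rw [EssentialBound, hcut.card_sideV hs hB, Finset.card_insert_of_notMem hxy,
    Finset.card_insert_of_notMem hca] at hb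
  have hne : G.card + 1 + 1 + 2 ≠ (S.filter (cr x y c)).card + 3 := by
    intro heq
    have hmem : s(y, b) ∈ sideB cr B x y c a :=
      mem_sideB.2 (.inr (.inr (sideE_mono h.sub (h.mem_near))))
    rw [← (hb.2 heq).1, Finset.mem_insert, Finset.mem_insert] at hmem
    rcases hmem with hmem | hmem | hmem
    · exact h.notMem hs (hmem ▸ h.sub h.mem)
    · exact hcut.notMem_sideE hs (hmem ▸ h.mem_near)
    · exact h.stuck (hGs _ _ hmem)
  have hle : ∀ g, (∀ p q, s(p, q) ∈ sideE cr E x y c → (Leaf B x ∧ ∃ b', cr x y c b' ∧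
      s(p, q) = s(x, b')) → s(p, q) = g) →
      sideE cr E x y c ⊆ insert s(y, b) (insert g G) := by
    intro g hg f
    induction f with | _ p q
    intro hpq
    simp only [Finset.mem_insert]
    rcases h.privateSide_or_leaf hs hB hpq with h1 | h1 | h1
    · exact .inr (.inr (hmemG p q hpq h1))
    · exact .inl h1
    · exact .inr (.inl (hg p q hpq h1))
  constructor
  · obtain ⟨g, hg⟩ : ∃ g, ∀ p q, s(p, q) ∈ sideE cr E x y c → (Leaf B x ∧ ∃ b', cr x y c b' ∧
        s(p, q) = s(x, b')) → s(p, q) = g := by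
      by_cases hex : ∃ d, Leaf B x ∧ s(x, d) ∈ B
      · obtain ⟨d, hx, hd⟩ := hex
        refine ⟨s(x, d), fun p q hpq ⟨_, b', _, heq⟩ => ?_⟩
        rw [heq, hx b' d (heq ▸ h.sub (sideE_subset hpq)) hd]
      · refine ⟨s(x, y), fun p q hpq ⟨hx, b', _, heq⟩ => ?_⟩
        exact absurd ⟨b', hx, heq ▸ h.sub (sideE_subset hpq)⟩ hex
    have := Finset.card_le_card (hle g hg)
    have := Finset.card_insert_le s(y, b) (insert g G)
    have := Finset.card_insert_le g G
    omega
  · rintro ⟨d, hd, hcd⟩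
    obtain ⟨k, hk⟩ := h.exists_key hs
    have := Finset.card_le_card (hle s(y, b) fun p q hpq ⟨hx, b', hb', heq⟩ => by
      obtain rfl := hx b' d (heq ▸ h.sub (sideE_subset hpq)) hd
      rw [hk.cross_iff'] at hb'
      rw [hk.cross_iff] at hcd
      omega)
    rw [Finset.insert_idem] at this
    have := Finset.card_insert_le s(y, b) G
    omega

lemma card_near_le [Finite V] (hs : IsSep cr) (hB : Braced cr S B)
    (ih : BoundBelow cr S.card) (h : StuckCut cr S B E x y a c b) :
    (sideE cr E x y c).card ≤ (S.filter (cr x y c)).card := by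
  by_cases hcr : Crossed cr (sideV cr S x y c) (insert s(c, a) (sideE cr B x y c))
  · have := (h.bound_near hs hB ih hcr).1
    rw [h.card_near hs, (h.toCut.swap_ends hs).card_sideV hs hB] at this
    omega
  · exact (h.card_of_not_crossed hs hB ih hcr).1

/-- If no brace joins `x` to the side of `c`, then that side stays braced after contracting the
other side to `a`. -/
lemma card_far_of_no_brace [Finite V] (hs : IsSep cr) (hB : Braced cr S B)
    (ih : BoundBelow cr S.card) (h : StuckCut cr S B E x y a c b)
    (hfar : ∀ p q, s(p, q) ∈ sideE cr E x y a → PrivateSide cr S B x y a p q)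
    (hx : ∀ d, s(x, d) ∈ B → ¬ cr x y a d) :
    (sideE cr E x y a).card + 2 ≤ (S.filter (cr x y a)).card := by
  obtain ⟨k, hk⟩ := h.exists_key hs
  have hxa := hk.xa; have hay := hk.ay; have hyc := hk.yc
  have haS := hB.mem _ _ h.brace
  have hcS := hB.mem_right h.brace
  have hxS := h.left; have hyS := h.right
  simp only [hk.cross_iff] at hx
  have hb := hk.cross_iff'.1 h.near
  have hy : ∀ v, s(y, v) ∈ B → ¬ k y < k v := by
    intro v hv
    rw [h.eq_of_brace hv]
    omega
  -- a brace at a point beyond `y` stays beyond `y`, unless it is `s(a, c)`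
  have hout : ∀ p q, s(p, q) ∈ B → k y < k p → k y < k q ∨ q = a ∧ p = c := by
    intro p q hpq hp
    by_contra! hcon
    have hqx : k q ≠ k x := by
      intro heq
      obtain rfl := hk.inj heq
      exact hx p (by rwa [Sym2.eq_swap]) hp
    have hqy : k q ≠ k y := by
      intro heq
      obtain rfl := hk.inj heq
      exact hy p (by rwa [Sym2.eq_swap]) hp
    have := hk.min q
    have := hk.sep_symm hpq (by omega) (by omega) hp
    exact hcon.2 this.1 this.2
  have hout' : ∀ p q, s(p, q) ∈ B → k y < k q → k y < k p ∨ p = a ∧ q = c := fun p q hpq =>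
    hout q p (by rwa [Sym2.eq_swap])
  have hE2 : ∀ p q, s(p, q) ∈ sideE cr B x y a ↔ s(p, q) ∈ B ∧ k y < k p ∧ k y < k q := by
    intro p q
    rw [hk.mem_sideE]
    refine and_congr_right fun hpq => ⟨fun ⟨hp, hq⟩ => ?_, fun ⟨hp, hq⟩ => by omega⟩
    have := hk.min p; have := hk.min q
    have hne := hB.ne hs hpq
    by_contra hcon
    have hp' : ¬ k y < k p := fun hlt => by
      rcases hout p q hpq hlt with h1 | ⟨rfl, rfl⟩ <;> omega
    have hq' : ¬ k y < k q := fun hlt => by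
      rcases hout' p q hpq hlt with h1 | ⟨rfl, rfl⟩ <;> omega
    have hne' : k p ≠ k q := fun heq => hne (hk.inj heq)
    have : k p = k x ∧ k q = k y ∨ k p = k y ∧ k q = k x := by omega
    rcases this with ⟨h1, h2⟩ | ⟨h1, h2⟩ <;> obtain rfl := hk.inj h1 <;> obtain rfl := hk.inj h2
    · exact h.notMem hs hpq
    · exact h.notMem hs (by rwa [Sym2.eq_swap])
  obtain ⟨v0, hv0, hcv0, hv0c⟩ := (h.toCut.swap_ends hs).exists_ne_of_not_leaf hs hB h.big_c
  rw [hk.cross_iff] at hcv0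
  rw [Ne, hk.eq_iff] at hv0c
  obtain ⟨l, hl, hyl, hlc⟩ : ∃ l ∈ S, k y < k l ∧ k l < k c := by
    by_contra! hcon
    have := hcon v0 hv0 hcv0
    obtain ⟨i, j, hij, hcr⟩ := hB.crossed x hxS c hcS
      ⟨v0, hv0, y, hyS, by rw [hk.iff]; unfold Cross; omega⟩
    rw [hk.iff] at hcr
    have h1 := hcon i (hB.mem _ _ hij); have h2 := hcon j (hB.mem_right hij)
    have h3 := hout i j hij; have h4 := hout' i j hij
    simp only [hk.eq_iff] at h3 h4
    have := hk.min i; have := hk.min j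
    unfold Cross at hcr
    omega
  obtain ⟨r, hr, hcr⟩ : ∃ r ∈ S, k c < k r := by
    by_contra! hcon
    have := hcon v0 hv0
    obtain ⟨i, j, hij, hcr⟩ := hB.crossed y hyS c hcS
      ⟨v0, hv0, x, hxS, by rw [hk.iff]; unfold Cross; omega⟩
    rw [hk.iff] at hcr
    have h1 := hcon i (hB.mem _ _ hij); have h2 := hcon j (hB.mem_right hij)
    have h3 := hout i j hij; have h4 := hout' i j hij
    simp only [hk.eq_iff] at h3 h4
    have := hk.min i; have := hk.min j
    unfold Cross at hcr
    omega
  set C := S.filter (cr x y a) with hC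
  have memC : ∀ v, v ∈ C ↔ v ∈ S ∧ k y < k v := fun v => by
    rw [hC, Finset.mem_filter, hk.cross_iff]
  have haC : a ∉ C := fun hmem => by have := ((memC a).1 hmem).2; omega
  have memS : ∀ v, v ∈ insert a C ↔ k v = k a ∨ v ∈ S ∧ k y < k v := fun v => by
    rw [Finset.mem_insert, memC, hk.eq_iff]
  have hcard3 : 3 ≤ C.card := by
    refine le_of_eq_of_le ?_ (Finset.card_le_card (s := {l, c, r}) ?_)
    · rw [Finset.card_insert_of_notMem, Finset.card_pair]
      · rw [Ne, hk.eq_iff]; omega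
      · simp only [Finset.mem_insert, Finset.mem_singleton, hk.eq_iff]; omega
    · intro v hv
      simp only [Finset.mem_insert, Finset.mem_singleton] at hv
      rw [memC]
      rcases hv with rfl | rfl | rfl
      · exact ⟨hl, hyl⟩
      · exact ⟨hcS, hyc⟩
      · exact ⟨hr, by omega⟩
  have hdisj : ∀ p q, s(p, q) ∈ insert s(c, a) (sideE cr B x y a) → s(p, q) ∈ B ∧
      (k y < k p ∨ p = a ∧ q = c) ∧ (k y < k q ∨ q = a ∧ p = c) := by
    intro p q hpq
    rcases Finset.mem_insert.1 hpq with hpq | hpq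
    · rcases Sym2.eq_iff.1 hpq with ⟨rfl, rfl⟩ | ⟨rfl, rfl⟩
      · exact ⟨by rw [Sym2.eq_swap]; exact h.brace, .inl hyc, .inr ⟨rfl, rfl⟩⟩
      · exact ⟨h.brace, .inr ⟨rfl, rfl⟩, .inl hyc⟩
    · rw [hE2] at hpq
      exact ⟨hpq.1, .inl hpq.2.1, .inl hpq.2.2⟩
  have hmk : ∀ p q, s(p, q) ∈ B → k y < k p ∨ k y < k q →
      s(p, q) ∈ insert s(c, a) (sideE cr B x y a) := by
    intro p q hpq hlt
    rw [Finset.mem_insert]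
    by_contra! hcon
    rw [Ne, Sym2.eq_iff, hE2] at hcon
    have h3 := hout p q hpq; have h4 := hout' p q hpq
    tauto
  have hBr : Braced cr (insert a C) (insert s(c, a) (sideE cr B x y a)) := by
    refine ⟨?_, ?_, ?_, ?_⟩
    · rw [Finset.card_insert_of_notMem haC]; omega
    · intro p q hpq
      obtain ⟨h1, h2, -⟩ := hdisj p q hpq
      rw [memS]
      rcases h2 with h2 | ⟨rfl, -⟩
      · exact .inr ⟨hB.mem _ _ h1, h2⟩
      · exact .inl rfl
    · intro p q hpq
      rcases Finset.mem_insert.1 hpq with hpq | hpq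
      · refine ⟨l, (memS l).2 (.inr ⟨hl, hyl⟩), r, (memS r).2 (.inr ⟨hr, by omega⟩), ?_⟩
        rw [hk.iff]; unfold Cross
        rcases Sym2.eq_iff.1 hpq with ⟨rfl, rfl⟩ | ⟨rfl, rfl⟩ <;> omega
      · rw [hE2] at hpq
        obtain ⟨u, hu, v, hv, huv⟩ := hB.diag _ _ hpq.1
        rw [hk.iff] at huv; unfold Cross at huv
        by_cases huy : k y < k u
        · by_cases hvy : k y < k v
          · exact ⟨u, (memS u).2 (.inr ⟨hu, huy⟩), v, (memS v).2 (.inr ⟨hv, hvy⟩),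
              by rw [hk.iff]; unfold Cross; omega⟩
          · exact ⟨u, (memS u).2 (.inr ⟨hu, huy⟩), a, (memS a).2 (.inl rfl),
              by rw [hk.iff]; unfold Cross; omega⟩
        · exact ⟨a, (memS a).2 (.inl rfl), v, (memS v).2 (.inr ⟨hv, by omega⟩),
              by rw [hk.iff]; unfold Cross; omega⟩
    · have pair : ∀ w ∈ S, k y < k w → (∃ u ∈ S, k y < k u ∧ k u < k w) →
          (∃ u ∈ S, k w < k u) → ∃ p q, s(p, q) ∈ insert s(c, a) (sideE cr B x y a) ∧
            k y < k p ∧ k p < k w ∧ k w < k q := by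
        rintro w hw hyw ⟨u, hu, hyu, huw⟩ ⟨v, hv, hwv⟩
        have sym : ∀ i j, s(i, j) ∈ B → (k y < k i ∧ k i < k w ∧ k w < k j ∨
            k y < k j ∧ k j < k w ∧ k w < k i) →
            ∃ p q, s(p, q) ∈ insert s(c, a) (sideE cr B x y a) ∧
            k y < k p ∧ k p < k w ∧ k w < k q := by
          rintro i j hij (hlt | hlt)
          · exact ⟨i, j, hmk i j hij (.inl hlt.1), hlt⟩
          · exact ⟨j, i, Sym2.eq_swap (a := j) ▸ hmk i j hij (.inr hlt.1), hlt⟩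
        obtain ⟨i, j, hij, hijc⟩ := hB.crossed x hxS w hw
          ⟨y, hyS, v, hv, by rw [hk.iff]; unfold Cross; omega⟩
        obtain ⟨i', j', hij', hijc'⟩ := hB.crossed y hyS w hw
          ⟨u, hu, v, hv, by rw [hk.iff]; unfold Cross; omega⟩
        rw [hk.iff] at hijc hijc'; unfold Cross at hijc hijc'
        have h1 := hout i j hij; have h2 := hout' i j hij
        have h3 := hout i' j' hij'; have h4 := hout' i' j' hij'
        simp only [hk.eq_iff] at h1 h2 h3 h4
        have := hk.min i; have := hk.min j; have := hk.min i'; have := hk.min j'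
        by_cases hcw : k c ≤ k w
        · exact sym i j hij (by omega)
        · exact sym i' j' hij' (by omega)
      rintro z hz w hw ⟨p, hp, q, hq, hpq⟩
      rw [memS] at hz hw hp hq
      rw [hk.iff] at hpq; unfold Cross at hpq
      rcases hz with hz | ⟨hzS, hz⟩
      · rcases hw with hw | ⟨hwS, hw⟩
        · omega
        · obtain ⟨i, j, hij, hlt⟩ := pair w hwS hw
            (by
              by_cases hpw : k p < k w
              · exact ⟨p, (hp.resolve_left (by omega)).1, by omega, hpw⟩
              · exact ⟨q, (hq.resolve_left (by omega)).1, by omega, by omega⟩)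
            (by
              by_cases hpw : k p < k w
              · exact ⟨q, (hq.resolve_left (by omega)).1, by omega⟩
              · exact ⟨p, (hp.resolve_left (by omega)).1, by omega⟩)
          exact ⟨i, j, hij, by rw [hk.iff]; unfold Cross; omega⟩
      · rcases hw with hw | ⟨hwS, hw⟩
        · obtain ⟨i, j, hij, hlt⟩ := pair z hzS hz
            (by
              by_cases hpw : k p < k z
              · exact ⟨p, (hp.resolve_left (by omega)).1, by omega, hpw⟩
              · exact ⟨q, (hq.resolve_left (by omega)).1, by omega, by omega⟩)
            (by
              by_cases hpw : k p < k z
              · exact ⟨q, (hq.resolve_left (by omega)).1, by omega⟩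
              · exact ⟨p, (hp.resolve_left (by omega)).1, by omega⟩)
          exact ⟨i, j, hij, by rw [hk.iff]; unfold Cross; omega⟩
        · have hpS : p ∈ S := hp.elim (fun h => hk.inj h ▸ haS) And.left
          have hqS : q ∈ S := hq.elim (fun h => hk.inj h ▸ haS) And.left
          obtain ⟨i, j, hij, hijc⟩ := hB.crossed z hzS w hwS
            ⟨p, hpS, q, hqS, by rw [hk.iff]; unfold Cross; omega⟩
          refine ⟨i, j, hmk i j hij ?_, hijc⟩
          rw [hk.iff] at hijc; unfold Cross at hijc
          omega
  have hess : Essential cr (insert a C) (insert s(c, a) (sideE cr B x y a))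
      (insert s(c, a) (sideE cr E x y a)) := by
    intro p q hpq
    rcases Finset.mem_insert.1 hpq with heq | hpq
    · obtain ⟨m, hm, hmin⟩ := C.exists_min_image k ⟨l, (memC l).2 ⟨hl, hyl⟩⟩
      obtain ⟨M, hM, hmax⟩ := C.exists_max_image k ⟨l, (memC l).2 ⟨hl, hyl⟩⟩
      have h1 := hmin l ((memC l).2 ⟨hl, hyl⟩)
      have h2 := hmax r ((memC r).2 ⟨hr, by omega⟩)
      have h3 := ((memC m).1 hm).2
      refine ⟨m, Finset.mem_insert_of_mem hm, M, Finset.mem_insert_of_mem hM, ?_, ?_⟩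
      · rw [hk.iff]; unfold Cross
        rcases Sym2.eq_iff.1 heq with ⟨rfl, rfl⟩ | ⟨rfl, rfl⟩ <;> omega
      · intro i j hij hijc
        rw [heq]
        refine (Finset.mem_insert.1 hij).resolve_right fun hij => ?_
        rw [hE2] at hij
        have h4 := hmin i ((memC i).2 ⟨hB.mem _ _ hij.1, hij.2.1⟩)
        have h5 := hmin j ((memC j).2 ⟨hB.mem_right hij.1, hij.2.2⟩)
        have h6 := hmax i ((memC i).2 ⟨hB.mem _ _ hij.1, hij.2.1⟩)
        have h7 := hmax j ((memC j).2 ⟨hB.mem_right hij.1, hij.2.2⟩)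
        rw [hk.iff] at hijc; unfold Cross at hijc
        omega
    · obtain ⟨z, hz, w, hw, hz', hw', hP⟩ := hfar p q hpq
      rw [hk.closed_iff] at hz' hw'
      obtain ⟨-, hp, hq⟩ := (hE2 p q).1 (sideE_mono h.sub hpq)
      have hcr' := (hk.iff _ _ _ _).1 hP.1
      have := hk.min z; have := hk.min w
      have single : ∀ w ∈ S, k y < k w → ∀ z, Private cr B z w p q → k z ≤ k y →
          ∃ z ∈ insert a C, ∃ w ∈ insert a C,
            Private cr (insert s(c, a) (sideE cr B x y a)) z w p q := by
        intro w hw hyw z hP hz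
        have hcr' := (hk.iff _ _ _ _).1 hP.1
        refine ⟨a, Finset.mem_insert_self _ _, w, (memS w).2 (.inr ⟨hw, hyw⟩), ?_, ?_⟩
        · rw [hk.iff]; unfold Cross at hcr' ⊢; omega
        · intro i j hij hijc
          obtain ⟨h1, h2, h3⟩ := hdisj i j hij
          refine hP.2 i j h1 ?_
          rw [hk.iff] at hijc ⊢
          simp only [hk.eq_iff] at h2 h3
          unfold Cross at hijc ⊢
          omega
      by_cases hzy : k y < k z
      · by_cases hwy : k y < k w
        · exact ⟨z, (memS z).2 (.inr ⟨hz, hzy⟩), w, (memS w).2 (.inr ⟨hw, hwy⟩), hP.1,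
            fun i j hij hijc => hP.2 i j (hdisj i j hij).1 hijc⟩
        · exact single z hz hzy w (hP.swap hs) (by omega)
      · refine single w hw ?_ z hP (by omega)
        unfold Cross at hcr'
        omega
  have := (ih _ _ _ ?_ hBr (Finset.insert_subset_insert _ (sideE_mono h.sub)) hess).1
  · rw [Finset.card_insert_of_notMem haC, Finset.card_insert_of_notMem] at this
    · omega
    · intro hmem
      have := (hE2 c a).1 (sideE_mono h.sub hmem)
      omega
  · have := h.card_eq hs
    rw [← hC] at this
    rw [Finset.card_insert_of_notMem haC]
    omega

end StuckCut

lemma Leaf.of_forall {B' : Finset (Sym2 V)} {v : V} (h : Leaf B v)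
    (hsub : ∀ w, s(v, w) ∈ B' → s(v, w) ∈ B) : Leaf B' v :=
  fun w w' h1 h2 => h w w' (hsub w h1) (hsub w' h2)

namespace StuckCut

variable {b d : V}

lemma privateSide_or_eq [Finite V] (hs : IsSep cr) (hB : Braced cr S B)
    (h : StuckCut cr S B E x y a c b) (hd : s(x, d) ∈ B) (hcd : cr x y a d) {p q : V}
    (hpq : s(p, q) ∈ sideE cr E x y c) :
    PrivateSide cr S B x y c p q ∨ s(p, q) = s(y, b) := by
  rcases h.privateSide_or_leaf hs hB hpq with h1 | h1 | ⟨hx, b', hb', heq⟩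
  · exact .inl h1
  · exact .inr h1
  · obtain rfl := hx b' d (heq ▸ h.sub (sideE_subset hpq)) hd
    obtain ⟨k, hk⟩ := h.exists_key hs
    rw [hk.cross_iff'] at hb'
    rw [hk.cross_iff] at hcd
    omega

lemma extremal_far [Finite V] (hs : IsSep cr) (hB : Braced cr S B)
    (ih : BoundBelow cr S.card) (h : StuckCut cr S B E x y a c b)
    (hfar : ∀ p q, s(p, q) ∈ sideE cr E x y a → PrivateSide cr S B x y a p q)
    (hcard : (sideE cr E x y a).card + 1 = (S.filter (cr x y a)).card) :
    insert s(x, y) (insert s(a, c) (sideE cr E x y a)) = sideB cr B x y a c ∧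
      LeavesConsecutive cr (sideV cr S x y a) (sideB cr B x y a c) ∧
      Leaf (sideB cr B x y a c) y := by
  obtain ⟨k, hk⟩ := h.exists_key hs
  have hxa := hk.xa; have hay := hk.ay; have hyc := hk.yc
  have hB' := h.braced_side hs hB
  have hy : Leaf (sideB cr B x y a c) y := by
    have key : ∀ w, s(y, w) ∈ sideB cr B x y a c → w = x := by
      intro w hw
      rcases mem_sideB.1 hw with hw | hw | hw
      · rw [Sym2.eq_swap (a := x)] at hw
        exact Sym2.congr_right.1 hw
      · rcases Sym2.eq_iff.1 hw with ⟨rfl, rfl⟩ | ⟨rfl, rfl⟩ <;> omega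
      · obtain rfl := h.eq_of_brace (sideE_subset hw)
        have := hk.cross_iff'.1 h.near
        rw [hk.mem_sideE] at hw
        omega
    exact fun w w' hw hw' => (key w hw).trans (key w' hw').symm
  have hess : Essential cr (sideV cr S x y a) (sideB cr B x y a c)
      (insert s(x, y) (insert s(a, c) (sideE cr E x y a))) := by
    intro p q hpq
    rcases Finset.mem_insert.1 hpq with heq | hpq
    · obtain ⟨z, hz, w, hw, hP⟩ := hB'.private_of_leaf hs (q := x) hy
        (by rw [Sym2.eq_swap]; exact mem_sideB.2 (.inl rfl))
      rcases Sym2.eq_iff.1 heq with ⟨rfl, rfl⟩ | ⟨rfl, rfl⟩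
      · exact ⟨z, hz, w, hw, hP.symm hs⟩
      · exact ⟨z, hz, w, hw, hP⟩
    · exact h.essential_side hs hfar p q hpq
  have hxy : s(x, y) ∉ insert s(a, c) (sideE cr E x y a) := by
    rw [Finset.mem_insert, not_or]
    exact ⟨h.ne_pair hs, fun hmem => h.notMem hs (h.sub (sideE_subset hmem))⟩
  have hb := ih _ _ _ (h.card_sideV_lt hs hB h.big_a) hB'
    (Finset.insert_subset_insert _ (Finset.insert_subset_insert _ (sideE_mono h.sub))) hess
  rw [EssentialBound, h.card_sideV hs hB, Finset.card_insert_of_notMem hxy,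
    Finset.card_insert_of_notMem (h.notMem_sideE hs)] at hb
  obtain ⟨h1, h2⟩ := hb.2 (by omega)
  exact ⟨h1, h2, hy⟩

lemma extremal_near [Finite V] (hs : IsSep cr) (hB : Braced cr S B)
    (ih : BoundBelow cr S.card) (h : StuckCut cr S B E x y a c b)
    (hd : s(x, d) ∈ B) (hcd : cr x y a d)
    (hcard : (sideE cr E x y c).card = (S.filter (cr x y c)).card)
    (hEq : insert s(c, a) (sideE cr E x y c) = insert s(c, a) (sideE cr B x y c)) :
    LeavesConsecutive cr (sideV cr S x y c) ((sideB cr B x y c a).erase s(y, b)) ∧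
      Leaf ((sideB cr B x y c a).erase s(y, b)) y := by
  obtain ⟨k, hk⟩ := h.exists_key hs
  have hxa := hk.xa; have hay := hk.ay; have hyc := hk.yc
  have hcut := h.toCut.swap_ends hs
  have hB' := hcut.braced_side hs hB
  have hxy : s(x, y) ∉ insert s(c, a) (sideE cr B x y c) := by
    rw [Finset.mem_insert, not_or]
    exact ⟨hcut.ne_pair hs, fun hmem => h.notMem hs (sideE_subset hmem)⟩
  have hF : insert s(c, a) (sideE cr E x y c) ⊆ sideB cr B x y c a :=
    hEq ▸ Finset.subset_insert _ _
  have hess : ∀ p q, s(p, q) ∈ insert s(c, a) (sideE cr E x y c) → s(p, q) ≠ s(y, b) →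
      ∃ z ∈ sideV cr S x y c, ∃ w ∈ sideV cr S x y c,
        Private cr (sideB cr B x y c a) z w p q := by
    intro p q hpq hne
    have hess := hcut.essential_side hs
      (E' := (sideE cr E x y c).erase s(y, b)) fun p q hpq =>
        (h.privateSide_or_eq hs hB hd hcd (Finset.mem_of_mem_erase hpq)).resolve_right
          (Finset.ne_of_mem_erase hpq)
    refine hess p q ?_
    rw [Finset.mem_insert] at hpq ⊢
    exact hpq.imp_right fun hmem => Finset.mem_erase.2 ⟨hne, hmem⟩
  have hcr : Crossed cr (sideV cr S x y c) ((sideB cr B x y c a).erase s(y, b)) := by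
    by_contra hcr
    obtain ⟨z, hz, w, hw, hP⟩ := hB'.exists_private_of_not_crossed (p := y) (q := b) hs
      (fun f hf => or_iff_not_imp_left.2 fun hne => Finset.mem_erase.2 ⟨hne, hf⟩) hcr
    have hb := ih _ _ _ (hcut.card_sideV_lt hs hB h.big_c) hB' hF fun p q hpq => by
      by_cases heq : s(p, q) = s(y, b)
      · rcases Sym2.eq_iff.1 heq with ⟨rfl, rfl⟩ | ⟨rfl, rfl⟩
        · exact ⟨z, hz, w, hw, hP⟩
        · exact ⟨z, hz, w, hw, hP.symm hs⟩
      · exact hess p q hpq heq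
    rw [EssentialBound, h.card_near hs, hcut.card_sideV hs hB, hcard] at hb
    have hmem : s(x, y) ∈ sideB cr B x y c a := mem_sideB.2 (.inl rfl)
    rw [← (hb.2 (by omega)).1, hEq] at hmem
    exact hxy hmem
  have hB3 := hB'.mono (Finset.erase_subset _ _) hcr
  have hbk := hk.cross_iff'.1 h.near
  have hyl : Leaf ((sideB cr B x y c a).erase s(y, b)) y := by
    have key : ∀ w, s(y, w) ∈ (sideB cr B x y c a).erase s(y, b) → w = x := by
      intro w hw
      rw [Finset.mem_erase] at hw
      rcases mem_sideB.1 hw.2 with hw | hw | hw'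
      · rw [Sym2.eq_swap (a := x)] at hw
        exact Sym2.congr_right.1 hw
      · rcases Sym2.eq_iff.1 hw with ⟨rfl, rfl⟩ | ⟨rfl, rfl⟩ <;> omega
      · obtain rfl := h.eq_of_brace (sideE_subset hw')
        exact absurd rfl hw.1
    exact fun w w' hw hw' => (key w hw).trans (key w' hw').symm
  have hne : s(x, y) ≠ s(y, b) := by
    rw [Ne, Sym2.eq_iff, hk.eq_iff, hk.eq_iff, hk.eq_iff, hk.eq_iff]; omega
  have hmemg : s(y, b) ∈ sideB cr B x y c a :=
    mem_sideB.2 (.inr (.inr (sideE_mono h.sub h.mem_near)))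
  have hb := ih _ _ _ (hcut.card_sideV_lt hs hB h.big_c) hB3 (Finset.Subset.refl _) (by
    intro p q hpq
    rw [Finset.mem_erase] at hpq
    rcases Finset.mem_insert.1 hpq.2 with heq | hpq'
    · obtain ⟨z, hz, w, hw, hP⟩ := hB3.private_of_leaf hs (q := x) hyl
        (by rw [Sym2.eq_swap (a := y) (b := x)]; exact Finset.mem_erase.2 ⟨hne, mem_sideB.2 (.inl rfl)⟩)
      rcases Sym2.eq_iff.1 heq with ⟨rfl, rfl⟩ | ⟨rfl, rfl⟩
      · exact ⟨z, hz, w, hw, hP.symm hs⟩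
      · exact ⟨z, hz, w, hw, hP⟩
    · obtain ⟨z, hz, w, hw, hP⟩ := hess p q (hEq ▸ hpq') hpq.1
      exact ⟨z, hz, w, hw, hP.mono (Finset.erase_subset _ _)⟩)
  refine ⟨(hb.2 ?_).2, hyl⟩
  rw [Finset.card_erase_of_mem hmemg, sideB, Finset.card_insert_of_notMem hxy, ← hEq,
    h.card_near hs, hcut.card_sideV hs hB]
  omega

/-- In the extremal case on the side of `a`, non-leaves come before leaves. -/
lemma not_leaf_before [Finite V] (hs : IsSep cr) (hB : Braced cr S B)
    (h : StuckCut cr S B E x y a c b) (hd : s(x, d) ∈ B) (hcd : cr x y a d)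
    (hcr : Crossed cr (sideV cr S x y c) (insert s(c, a) (sideE cr B x y c)))
    (hcard : (insert s(c, a) (sideE cr B x y c)).card + 2 = (sideV cr S x y c).card)
    (hEB : sideE cr E x y c = sideE cr B x y c)
    (hLC : LeavesConsecutive cr (sideV cr S x y c) (insert s(c, a) (sideE cr B x y c)))
    (hLC' : LeavesConsecutive cr (sideV cr S x y c) ((sideB cr B x y c a).erase s(y, b)))
    (hy' : Leaf ((sideB cr B x y c a).erase s(y, b)) y) {k : V → ℤ} (hk : CutKey cr B x y a c k)
    {p v : V} (hp : p ∈ S) (hv : v ∈ S) (hxp : k x < k p) (hpv : k p < k v) (hvy : k v < k y)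
    (hpl : Leaf B p) (hvb : ¬ Leaf B v) : False := by
  have hxa := hk.xa; have hay := hk.ay; have hyc := hk.yc
  have hxS := h.left; have hyS := h.right
  have haS := hB.mem _ _ h.brace
  have hcS := hB.mem_right h.brace
  have hbk := hk.cross_iff'.1 h.near
  set B1 := insert s(c, a) (sideE cr B x y c) with hB1
  set B3 := (sideB cr B x y c a).erase s(y, b) with hB3
  have hS1 : ∀ v ∈ S, k v ≤ k y → v ∈ sideV cr S x y c := by
    intro v hv hvy
    rw [BracedPolygon.mem_sideV]
    have := hk.closed_iff'.2 hvy
    tauto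
  have hcS1 : c ∈ sideV cr S x y c := mem_sideV.2 ⟨hcS, .inr (.inr (.inl rfl))⟩
  have mem1 : ∀ p q, s(p, q) ∈ B1 ↔ p = c ∧ q = a ∨ p = a ∧ q = c ∨
      s(p, q) ∈ B ∧ k p ≤ k y ∧ k q ≤ k y := by
    intro p q
    rw [hB1, Finset.mem_insert, hk.mem_sideE', Sym2.eq_iff, or_assoc]
  -- braces at a point of the side of `a`
  have inner : ∀ u w, s(u, w) ∈ B → k x < k u → k u < k y → s(u, w) ∈ B1 := by
    intro u w huw hu hu'
    rw [mem1]
    by_cases hw : k w ≤ k y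
    · exact .inr (.inr ⟨huw, hu'.le, hw⟩)
    · exact .inr (.inl (hk.sep u w huw hu hu' (by omega)))
  have sub1 : B1 ⊆ B := h.subset
  have big1 : ∀ u, k x < k u → k u < k y → ¬ Leaf B u → ¬ Leaf B1 u := fun u hu hu' hb hl =>
    hb (hl.of_forall fun w hw => inner u w hw hu hu')
  have big3 : ∀ u, k x < k u → k u < k y → ¬ Leaf B u → u ≠ b → ¬ Leaf B3 u := by
    intro u hu hu' hb hub hl
    refine hb (hl.of_forall fun w hw => ?_)
    rw [hB3, Finset.mem_erase]
    refine ⟨?_, Finset.mem_insert_of_mem (inner u w hw hu hu')⟩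
    rw [Ne, Sym2.eq_iff, hk.eq_iff (u := u)]
    rintro (⟨h1, -⟩ | ⟨h1, -⟩)
    · omega
    · exact hub h1
  have leaf3 : Leaf B3 p := by
    refine hpl.of_forall fun w hw => ?_
    rw [hB3, Finset.mem_erase] at hw
    rcases Finset.mem_insert.1 hw.2 with heq | hmem
    · rw [Sym2.eq_iff, hk.eq_iff, hk.eq_iff (u := p) (v := y)] at heq; omega
    · exact sub1 hmem
  obtain ⟨q, hq1⟩ := (h.braced_near hs hB hcr).exists_brace hs (hS1 x hxS (by omega))
  have hq1' := (mem1 x q).1 hq1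
  simp only [hk.eq_iff] at hq1'
  obtain ⟨hqB, -, hqy⟩ : s(x, q) ∈ B ∧ k x ≤ k y ∧ k q ≤ k y := by
    rcases hq1' with hq | hq | hq
    · omega
    · omega
    · exact hq
  have hqy' : k q < k y := by
    refine lt_of_le_of_ne hqy fun heq => h.notMem hs ?_
    rwa [hk.inj heq] at hqB
  have hxq : k x < k q := by
    have := hB.ne hs hqB
    rw [Ne, hk.eq_iff] at this
    have := hk.min q
    omega
  have hx3 : ¬ Leaf B3 x := by
    intro hl
    have := hl y q ?_ ?_
    · rw [this] at hqy'; omega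
    · rw [hB3, Finset.mem_erase, Ne, Sym2.eq_iff, hk.eq_iff, hk.eq_iff, hk.eq_iff, hk.eq_iff]
      exact ⟨by omega, mem_sideB.2 (.inl rfl)⟩
    · rw [hB3, Finset.mem_erase, Ne, Sym2.eq_iff, hk.eq_iff, hk.eq_iff, hk.eq_iff, hk.eq_iff]
      exact ⟨by omega, Finset.mem_insert_of_mem hq1⟩
  have hy1 : Leaf B1 y := h.leaf.mono sub1
  have after : ∀ u ∈ S, k p < k u → k u < k y → ¬ Leaf B u → u = b := by
    intro u hu hpu huy hub
    by_contra hne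
    exact hLC' x (hS1 x hxS (by omega)) u (hS1 u hu huy.le) p (hS1 p hp (by omega)) y
      (hS1 y hyS le_rfl) (by rw [hk.iff]; unfold Cross; omega) hx3
      (big3 u (by omega) huy hub hne) leaf3 hy'
  have before : ∀ u ∈ S, k x ≤ k u → k u < k p → ¬ Leaf B1 u → False := by
    intro u hu hxu hup hub
    exact hLC u (hS1 u hu (by omega)) v (hS1 v hv hvy.le) p (hS1 p hp (by omega)) y
      (hS1 y hyS le_rfl) (by rw [hk.iff]; unfold Cross; omega) hub
      (big1 v (by omega) hvy hvb) (hpl.mono sub1) hy1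
  obtain rfl := after v hv hpv hvy hvb
  have hav : v = a := by
    by_contra hav
    have hap : k a ≠ k p := fun heq => h.big_a (by rwa [hk.inj heq])
    rcases lt_or_gt_of_ne hap with hlt | hlt
    · exact before a haS (by omega) hlt (big1 a hxa hay h.big_a)
    · exact hav (after a haS hlt hay h.big_a).symm
  obtain rfl := hav
  have hx1 : Leaf B1 x := by
    by_contra hx1
    exact before x hxS le_rfl hxp hx1
  have leafA : ∀ u ∈ S, k x < k u → k u < k y → u ≠ v → Leaf B u := by
    intro u hu hxu huy hne
    by_contra hub
    have hup : k u ≠ k p := fun heq => hub (by rwa [hk.inj heq])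
    rcases lt_or_gt_of_ne hup with hlt | hlt
    · exact before u hu hxu.le hlt (big1 u hxu huy hub)
    · exact hne (after u hu hlt huy hub)
  have hqv : q ≠ v := by
    rintro rfl
    have hmem : s(x, q) ∈ sideE cr E x y c := by
      rw [hEB, hk.mem_sideE']
      exact ⟨hqB, by omega, hqy⟩
    rcases h.privateSide_or_eq hs hB hd hcd hmem with ⟨z, -, w, -, hz, hw, hP⟩ | heq
    · rw [hk.closed_iff'] at hz hw
      have hcr' := hP.1
      have := hP.2 q c h.brace
      rw [hk.iff, Sym2.eq_iff, hk.eq_iff, hk.eq_iff, hk.eq_iff, hk.eq_iff] at this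
      rw [hk.iff] at hcr'
      have := hk.min z; have := hk.min w
      unfold Cross at *
      omega
    · rw [Sym2.eq_iff, hk.eq_iff, hk.eq_iff, hk.eq_iff, hk.eq_iff] at heq
      omega
  obtain ⟨i, j, hij, hxi, hiv, hvj, hjy⟩ : ∃ i j, s(i, j) ∈ B1 ∧ k x < k i ∧ k i < k v ∧
      k v < k j ∧ k j < k y := by
    obtain ⟨i, j, hij, hijc⟩ := hcr x (hS1 x hxS (by omega)) v (hS1 v hv hvy.le)
      ⟨p, hS1 p hp (by omega), c, hcS1, by rw [hk.iff]; unfold Cross; omega⟩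
    rw [hk.iff] at hijc
    have key : ∀ i j, s(i, j) ∈ B1 → k x < k i → k i < k v → k v < k j → k j < k y := by
      intro i j hij hxi hiv hvj
      have h1 := (mem1 i j).1 hij
      rw [hk.eq_iff, hk.eq_iff, hk.eq_iff, hk.eq_iff] at h1
      refine lt_of_le_of_ne (by omega) fun heq => ?_
      obtain rfl := hk.inj heq
      obtain rfl := h.eq_of_brace (v := i) (by rw [Sym2.eq_swap]; exact sub1 hij)
      omega
    have := hk.min i; have := hk.min j
    by_cases hlt : k x < k i ∧ k i < k v
    · have : k v < k j := by unfold Cross at hijc; omega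
      exact ⟨i, j, hij, hlt.1, hlt.2, this, key i j hij hlt.1 hlt.2 this⟩
    · have hlt' : k x < k j ∧ k j < k v ∧ k v < k i := by unfold Cross at hijc; omega
      rw [Sym2.eq_swap] at hij
      exact ⟨j, i, hij, hlt'.1, hlt'.2.1, hlt'.2.2, key j i hij hlt'.1 hlt'.2.1 hlt'.2.2⟩
  have hijB := sub1 hij
  have hqk : k q ≠ k v := fun heq => hqv (hk.inj heq)
  have hql : Leaf B q := leafA q (hB.mem_right hqB) hxq hqy' hqv
  have hjl : Leaf B j := leafA j (hB.mem_right hijB) (by omega) hjy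
    (by rw [Ne, hk.eq_iff]; omega)
  have hq' : ∀ w, s(q, w) ∈ B → w = x := fun w hw =>
    hql w x hw (by rwa [Sym2.eq_swap])
  have hj' : ∀ w, s(j, w) ∈ B → w = i := fun w hw =>
    hjl w i hw (by rwa [Sym2.eq_swap])
  have hjq : j ≠ q := by
    rintro rfl
    have := hq' i (by rwa [Sym2.eq_swap])
    rw [hk.eq_iff] at this; omega
  have hiq : i ≠ q := by
    rintro rfl
    have := hq' j hijB
    rw [hk.eq_iff] at this; omega
  have hL : B1.card ≤ (((((sideV cr S x y c).erase v).erase q).erase j)).card := by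
    have hend : ∀ u w, s(u, w) ∈ B → (u = v ∨ u = q ∨ u = j) → (w = v ∨ w = q ∨ w = j) →
        False := by
      intro u w huw hu hw
      have hne := hB.ne hs huw
      have hwu : s(w, u) ∈ B := by rwa [Sym2.eq_swap]
      have h1 : u = q → w = x := fun heq => hq' w (heq ▸ huw)
      have h2 : w = q → u = x := fun heq => hq' u (heq ▸ hwu)
      have h3 : u = j → w = i := fun heq => hj' w (heq ▸ huw)
      have h4 : w = j → u = i := fun heq => hj' u (heq ▸ hwu)
      simp only [Ne, hk.eq_iff] at h1 h2 h3 h4 hu hw hne hjq hiq hqv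
      omega
    have memL : ∀ u, u ∈ (((sideV cr S x y c).erase v).erase q).erase j ↔
        u ∈ sideV cr S x y c ∧ ¬ (u = v ∨ u = q ∨ u = j) := by
      intro u
      simp only [Finset.mem_erase]; tauto
    refine card_le_of_leaf (Finset.Subset.refl _) (fun u hu => ?_) fun u w huw => ?_
    · rw [memL] at hu
      have hu1 := mem_sideV.1 hu.1
      rcases hu1.2 with rfl | rfl | rfl | hu2
      · exact hx1
      · exact hy1
      · have key : ∀ w, s(u, w) ∈ B1 → w = v := by
          intro w hw
          rw [mem1] at hw
          rcases hw with hw | ⟨hw, -⟩ | hw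
          · exact hw.2
          · rw [hk.eq_iff] at hw; omega
          · omega
        exact fun w w' hw hw' => (key w hw).trans (key w' hw').symm
      · rw [hk.cross_iff'] at hu2
        exact (leafA u hu1.1 hu2.1 hu2.2 (by tauto)).mono sub1
    · have hBr := h.braced_near hs hB hcr
      have h1 := hend u w (sub1 huw)
      have h2 := hBr.mem _ _ huw
      have h3 := hBr.mem_right huw
      rw [memL, memL]
      tauto
  rw [Finset.card_erase_of_mem, Finset.card_erase_of_mem, Finset.card_erase_of_mem] at hL
  · have := (h.braced_near hs hB hcr).card
    omega
  · exact hS1 v hv hvy.le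
  · exact Finset.mem_erase.2 ⟨hqv, hS1 q (hB.mem_right hqB) hqy⟩
  · refine Finset.mem_erase.2 ⟨hjq, Finset.mem_erase.2 ⟨?_, hS1 j (hB.mem_right hijB) hjy.le⟩⟩
    rw [Ne, hk.eq_iff]; omega

lemma extremal [Finite V] (hs : IsSep cr) (hB : Braced cr S B)
    (ih : BoundBelow cr S.card) (h : StuckCut cr S B E x y a c b) (hac : s(a, c) ∈ E)
    (hfar : ∀ p q, s(p, q) ∈ sideE cr E x y a → PrivateSide cr S B x y a p q)
    (hd : s(x, d) ∈ B) (hcd : cr x y a d)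
    (hcr : Crossed cr (sideV cr S x y c) (insert s(c, a) (sideE cr B x y c)))
    (hcard : (sideE cr E x y c).card = (S.filter (cr x y c)).card)
    (hcard' : (sideE cr E x y a).card + 1 = (S.filter (cr x y a)).card) :
    E = B ∧ LeavesConsecutive cr S B := by
  obtain ⟨k, hk⟩ := h.exists_key hs
  have hxa := hk.xa; have hay := hk.ay; have hyc := hk.yc
  have hxS := h.left; have hyS := h.right
  have hcut := h.toCut.swap_ends hs
  have hb1 := h.bound_near hs hB ih hcr
  have hcard1 : (insert s(c, a) (sideE cr E x y c)).card + 2 = (sideV cr S x y c).card := by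
    rw [h.card_near hs, hcut.card_sideV hs hB]; omega
  obtain ⟨hEq1, hLC1⟩ := hb1.2 hcard1
  obtain ⟨hEq2, hLC2, hy2⟩ := h.extremal_far hs hB ih hfar hcard'
  obtain ⟨hLC3, hy3⟩ := h.extremal_near hs hB ih hd hcd hcard hEq1
  have hEB1 : sideE cr E x y c = sideE cr B x y c := by
    refine (sideE_mono h.sub).antisymm fun f hf => ?_
    have : f ∈ insert s(c, a) (sideE cr E x y c) := hEq1 ▸ Finset.mem_insert_of_mem hf
    refine (Finset.mem_insert.1 this).resolve_left ?_
    rintro rfl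
    exact hcut.notMem_sideE hs hf
  have hEB2 : sideE cr B x y a ⊆ E := by
    intro f hf
    have : f ∈ insert s(x, y) (insert s(a, c) (sideE cr E x y a)) :=
      hEq2 ▸ mem_sideB.2 (.inr (.inr hf))
    rw [Finset.mem_insert, Finset.mem_insert] at this
    rcases this with rfl | rfl | hmem
    · exact absurd (sideE_subset hf) (h.notMem hs)
    · exact hac
    · exact sideE_subset hmem
  refine ⟨h.sub.antisymm fun f hf => ?_, ?_⟩
  · have := h.subset_sides hs (Finset.Subset.refl _) hf
    rw [Finset.mem_insert, Finset.mem_union, ← hEB1] at this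
    rcases this with rfl | hmem | hmem
    · exact hac
    · exact hEB2 hmem
    · exact sideE_subset hmem
  rw [hk.cross_iff] at hcd
  have hxb : ¬ Leaf (sideB cr B x y a c) x := by
    intro hl
    have := hl y d (mem_sideB.2 (.inl rfl)) (mem_sideB.2 (.inr (.inr ?_)))
    · rw [this] at hcd; omega
    · rw [hk.mem_sideE]
      exact ⟨hd, by omega, by omega⟩
  have hxB : ¬ Leaf B x := by
    intro hl
    obtain ⟨q, hq⟩ := (h.braced_near hs hB hcr).exists_brace hs
      (mem_sideV.2 ⟨hxS, .inl rfl⟩)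
    have heq := hl q d (h.subset hq) hd
    rw [heq, Finset.mem_insert, hk.mem_sideE', Sym2.eq_iff, hk.eq_iff, hk.eq_iff, hk.eq_iff,
      hk.eq_iff] at hq
    omega
  have outer : ∀ u, k y < k u → ∀ w, s(u, w) ∈ B ↔ s(u, w) ∈ sideB cr B x y a c := by
    intro u hu w
    rw [mem_sideB]
    constructor
    · intro huw
      have := h.subset_sides hs (Finset.Subset.refl _) huw
      rw [Finset.mem_insert, Finset.mem_union] at this
      rcases this with heq | hmem | hmem
      · exact .inr (.inl heq)
      · exact .inr (.inr hmem)
      · rw [hk.mem_sideE'] at hmem; omega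
    · rintro (heq | heq | hmem)
      · rw [Sym2.eq_iff, hk.eq_iff, hk.eq_iff (u := u) (v := y)] at heq; omega
      · rw [heq]; exact h.brace
      · exact sideE_subset hmem
  have mid : ∀ p ∈ S, ∀ q ∈ S, ∀ u ∈ S, Leaf B p → Leaf B q → ¬ Leaf B u → k p < k u →
      k u < k q → False := by
    intro p hp q hq u hu hpl hql hub hpu huq
    have := hk.min p
    rcases lt_trichotomy (k u) (k y) with hlt | heq | hlt
    · refine h.not_leaf_before hs hB hd (hk.cross_iff.2 hcd) hcr (hEB1 ▸ hcard1) hEB1 hLC1 hLC3 hy3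
        hk hp hu (lt_of_le_of_ne this fun heq => hxB ?_) hpu hlt hpl hub
      rwa [hk.inj heq]
    · exact hub (hk.inj heq ▸ h.leaf)
    · refine hLC2 x (hk.mem_sideV.2 ⟨hxS, by omega⟩) u (hk.mem_sideV.2 ⟨hu, by omega⟩) y
        (hk.mem_sideV.2 ⟨hyS, by omega⟩) q (hk.mem_sideV.2 ⟨hq, by omega⟩)
        (by rw [hk.iff]; unfold Cross; omega) hxb
        (fun hl => hub (hl.of_forall fun w hw => (outer u hlt w).1 hw)) hy2
        (hql.of_forall fun w hw => (outer q (by omega) w).2 hw)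
  intro u hu v hv p hp q hq hcr hub hvb hpl hql
  rw [hk.iff] at hcr
  by_cases h1 : k p < k u ∧ k u < k q
  · exact mid p hp q hq u hu hpl hql hub h1.1 h1.2
  by_cases h2 : k q < k u ∧ k u < k p
  · exact mid q hq p hp u hu hql hpl hub h2.1 h2.2
  by_cases h3 : k p < k v ∧ k v < k q
  · exact mid p hp q hq v hv hpl hql hvb h3.1 h3.2
  by_cases h4 : k q < k v ∧ k v < k p
  · exact mid q hq p hp v hv hql hpl hvb h4.1 h4.2
  unfold Cross at hcr
  omega

end StuckCut

lemma PrivateSide.symm (hs : IsSep cr) {p q : V} (h : PrivateSide cr S B x y a p q) :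
    PrivateSide cr S B x y a q p := by
  obtain ⟨z, hz, w, hw, hz', hw', hP⟩ := h
  exact ⟨z, hz, w, hw, hz', hw', hP.symm hs⟩

lemma PrivateSide.swap (hs : IsSep cr) {p q : V} (h : PrivateSide cr S B x y a p q) :
    PrivateSide cr S B y x a p q := by
  obtain ⟨z, hz, w, hw, hz', hw', hP⟩ := h
  rw [hs.swap_left, or_left_comm] at hz' hw'
  exact ⟨z, hz, w, hw, hz', hw', hP⟩

lemma StuckCut.essentialBound [Finite V] (hs : IsSep cr) (hB : Braced cr S B)
    (ih : BoundBelow cr S.card) {b : V} (h : StuckCut cr S B E x y a c b) (hac : s(a, c) ∈ E)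
    (hfar : ∀ p q, s(p, q) ∈ sideE cr E x y a → PrivateSide cr S B x y a p q) :
    EssentialBound cr S B E := by
  have h1 := h.card_near_le hs hB ih
  have h2 := h.card_sideE_lt hs hB ih h.big_a h.sub (fun hmem => h.notMem hs (h.sub hmem)) hfar
  have h3 := h.card_braces_le hs h.sub
  have h4 := h.card_eq hs
  refine ⟨by omega, fun heq => ?_⟩
  have hd : ∃ d, s(x, d) ∈ B ∧ cr x y a d := by
    by_contra! hcon
    have := h.card_far_of_no_brace hs hB ih hfar hcon
    omega
  have hcr : Crossed cr (sideV cr S x y c) (insert s(c, a) (sideE cr B x y c)) := by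
    by_contra hcr
    have := (h.card_of_not_crossed hs hB ih hcr).2 hd
    omega
  obtain ⟨d, hd, hcd⟩ := hd
  exact h.extremal hs hB ih hac hfar hd hcd hcr (by omega) (by omega)

lemma Cut.essentialBound [Finite V] (hs : IsSep cr) (hB : Braced cr S B)
    (ih : BoundBelow cr S.card) (h : Cut cr S B x y a c) (ha : ¬ Leaf B a) (hc : ¬ Leaf B c)
    (hE : E ⊆ B) (hEs : Essential cr S B E) (hac : s(a, c) ∈ E)
    (hfar : ∀ p q, s(p, q) ∈ sideE cr E x y a → PrivateSide cr S B x y a p q) :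
    EssentialBound cr S B E := by
  have hxy : s(x, y) ∉ E := fun hmem => h.not_privateSide_self hs
    (hfar x y (mem_sideE.2 ⟨hmem, .inl rfl, .inr (.inl rfl)⟩))
  by_cases hnear : ∀ p q, s(p, q) ∈ sideE cr E x y c → PrivateSide cr S B x y c p q
  · have h1 := (h.swap_ends hs).card_sideE_lt hs hB ih hc hE hxy hnear
    have h2 := h.card_sideE_lt hs hB ih ha hE hxy hfar
    have h3 := h.card_braces_le hs hE
    have h4 := h.card_eq hs
    exact ⟨by omega, fun heq => by omega⟩
  · push Not at hnear
    obtain ⟨p, q, hpq, hbad⟩ := hnear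
    have hstuck : ∀ u v, s(p, q) = s(u, v) → ¬ PrivateSide cr S B x y c u v := by
      intro u v heq hP
      rcases Sym2.eq_iff.1 heq with ⟨rfl, rfl⟩ | ⟨rfl, rfl⟩
      · exact hbad hP
      · exact hbad (hP.symm hs)
    have hpqE := sideE_subset hpq
    rcases h.privateSide_or_leaf hs hB hc hE hEs hpq (fun heq => hxy (heq ▸ hpqE)) with
      h1 | ⟨hy, b, hb, heq⟩ | ⟨hx, b, hb, heq⟩
    · exact absurd h1 hbad
    · have hst : StuckCut cr S B E x y a c b :=
        ⟨h, ha, hc, hE, hEs, hy, heq ▸ hpqE, hb, hstuck y b heq⟩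
      exact hst.essentialBound hs hB ih hac hfar
    · have hst : StuckCut cr S B E y x a c b :=
        ⟨h.swap hs, ha, hc, hE, hEs, hx, heq ▸ hpqE, hs.swap_left.1 hb,
          fun hP => hstuck x b heq (hP.swap hs)⟩
      exact hst.essentialBound hs hB ih hac fun p q hpq =>
        (hfar p q (by rwa [sideE_swap hs] at hpq)).swap hs

/-- A 3-connected polygon on `n` points has at most `n - 2` essential braces. If there are
`n - 2` of them, then there are no other braces, and the points with only one brace are
consecutive. -/
theorem Braced.essentialBound [Finite V] (hs : IsSep cr) (hB : Braced cr S B) (hE : E ⊆ B)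
    (hEs : Essential cr S B E) : EssentialBound cr S B E := by
  obtain ⟨n, hn⟩ : ∃ n, S.card = n := ⟨_, rfl⟩
  induction n using Nat.strong_induction_on generalizing S B E with
  | _ n ihn
  have ih : BoundBelow cr S.card := fun S' B' E' hlt hB' hE' hEs' =>
    ihn _ (hn ▸ hlt) hB' hE' hEs' rfl
  by_cases hex : ∃ a c, s(a, c) ∈ E ∧ ¬ Leaf B a ∧ ¬ Leaf B c
  · obtain ⟨a, c, hac, ha, hc⟩ := hex
    obtain ⟨x₀, hx₀, y₀, hy₀, hP⟩ := hEs a c hac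
    obtain ⟨⟨x, y⟩, hcut, hmin⟩ := exists_minimalFor_of_wellFoundedLT
      (fun z : V × V => Cut cr S B z.1 z.2 a c)
      (fun z => (S.filter (cr z.1 z.2 c)).card) ⟨(x₀, y₀), hx₀, hy₀, hE hac, hP⟩
    refine hcut.essentialBound hs hB ih ha hc hE hEs hac fun p q hpq =>
      hcut.privateSide_of_min hs hB ha (fun x' y' hcut' => ?_) hEs hpq
    by_contra! hlt
    exact absurd (hmin (j := (x', y')) hcut' hlt.le) (not_le.2 hlt)
  · exact essentialBound_of_leaf hs hB hE fun p q hpq => by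
      by_contra! hcon
      exact hex ⟨p, q, hpq, hcon⟩

/-- The separation relation of the cyclic order on `ZMod n`. -/
def zcr (n : ℕ) (x y a b : ZMod n) : Prop := Cross x.val y.val a.val b.val

section Polygon

variable {n : ℕ} [NeZero n] {D : Finset (Sym2 (ZMod n))}

lemma isKey_zcr : IsKey (zcr n) fun v => (v.val : ℤ) :=
  ⟨fun _ _ h => ZMod.val_injective n (Int.ofNat.inj h), fun _ _ _ _ => Iff.rfl⟩

lemma isSep_zcr : IsSep (zcr n) := ⟨_, isKey_zcr⟩

lemma val_sub_cases (x p : ZMod n) : ((x - p).val + p.val = x.val ∨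
    (x - p).val + p.val = x.val + n) ∧ x.val < n ∧ p.val < n ∧ (x - p).val < n := by
  refine ⟨?_, x.val_lt, p.val_lt, (x - p).val_lt⟩
  rcases lt_or_ge ((x - p).val + p.val) n with h | h
  · left
    rw [← ZMod.val_add_of_lt h, sub_add_cancel]
  · right
    have := ZMod.val_add_val_of_le h
    rwa [sub_add_cancel] at this

lemma val_add_one_cases (hn : 2 ≤ n) (i : ZMod n) :
    ((i + 1).val = i.val + 1 ∨ (i + 1).val = 0 ∧ i.val + 1 = n) ∧ i.val < n := by
  have h1 : (1 : ZMod n).val = 1 := ZMod.val_one'' (by omega)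
  have := val_sub_cases (i + 1) i
  rw [add_sub_cancel_left, h1] at this
  omega

lemma val_ne {v w : ZMod n} (h : v ≠ w) : v.val ≠ w.val := fun e => h (ZMod.val_injective n e)

lemma not_zcr_boundary (hn : 2 ≤ n) (x y i : ZMod n) : ¬ zcr n x y i (i + 1) := by
  have := val_add_one_cases hn i
  have := x.val_lt
  have := y.val_lt
  unfold zcr Cross
  omega

lemma crossed_of_threeConnected (hn : 2 ≤ n) (h : ThreeConnected (bpGraph n D)) :
    Crossed (zcr n) Finset.univ D := by
  rintro x - y - ⟨p, -, q, -, hpq⟩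
  by_contra! hno
  have hp : p ∉ ({x, y} : Finset (ZMod n)) := by
    simp only [Finset.mem_insert, Finset.mem_singleton]
    rintro (rfl | rfl) <;> (unfold zcr Cross at hpq; omega)
  have hq : q ∉ ({x, y} : Finset (ZMod n)) := by
    simp only [Finset.mem_insert, Finset.mem_singleton]
    rintro (rfl | rfl) <;> (unfold zcr Cross at hpq; omega)
  have hr := (h.2 {x, y} Finset.card_le_two).preconnected ⟨p, by simpa using hp⟩ ⟨q, by simpa using hq⟩
  rw [SimpleGraph.reachable_iff_reflTransGen] at hr
  have key : ∀ v : (((({x, y} : Finset (ZMod n)) : Set (ZMod n))ᶜ : Set (ZMod n))),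
      Relation.ReflTransGen ((bpGraph n D).induce _).Adj ⟨p, by simpa using hp⟩ v →
      ¬ zcr n x y p v := by
    intro v hv
    induction hv with
    | refl =>
      change ¬ zcr n x y p p
      unfold zcr Cross
      omega
    | @tail v w _ hvw ih =>
      have hvw' : ¬ zcr n x y v w := by
        have hadj : (bpGraph n D).Adj v w := hvw
        rw [bpGraph, SimpleGraph.fromEdgeSet_adj] at hadj
        rcases hadj.1 with hB | ⟨i, hi⟩
        · exact hno _ _ hB
        · rcases Sym2.eq_iff.1 hi with ⟨h1, h2⟩ | ⟨h1, h2⟩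
          · rw [h1, h2]; exact not_zcr_boundary hn x y i
          · rw [h1, h2, isSep_zcr.swap_right]; exact not_zcr_boundary hn x y i
      have hv := v.2
      have hw := w.2
      simp only [Finset.coe_insert, Finset.coe_singleton, Set.mem_compl_iff, Set.mem_insert_iff,
        Set.mem_singleton_iff, not_or] at hv hw
      have := val_ne hv.1
      have := val_ne hv.2
      have := val_ne hw.1
      have := val_ne hw.2
      unfold zcr Cross at *
      omega
  exact key _ hr hpq

lemma bpGraph_adj_add_one (hn : 2 ≤ n) (i : ZMod n) : (bpGraph n D).Adj i (i + 1) := by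
  rw [bpGraph, SimpleGraph.fromEdgeSet_adj]
  refine ⟨Or.inr ⟨i, rfl⟩, fun h => ?_⟩
  have := val_add_one_cases hn i
  rw [← h] at this
  omega

lemma reachable_of_arc (hn : 2 ≤ n) {s : Set (ZMod n)} (a : ZMod n) (k : ℕ)
    (h : ∀ j ≤ k, a + (j : ZMod n) ∈ s) {b : ZMod n} (hb : b = a + (k : ZMod n)) (ha : a ∈ s)
    (hbs : b ∈ s) : ((bpGraph n D).induce s).Reachable ⟨a, ha⟩ ⟨b, hbs⟩ := by
  induction k generalizing b with
  | zero =>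
    obtain rfl : b = a := by simpa using hb
    rfl
  | succ k ih =>
    refine (ih (fun j hj => h j (by omega)) rfl (h k (by omega))).trans (SimpleGraph.Adj.reachable ?_)
    subst hb
    have := bpGraph_adj_add_one (D := D) hn (a + (k : ZMod n))
    simpa [add_assoc] using this

lemma add_natCast_val_sub (a b : ZMod n) : a + ((b - a).val : ZMod n) = b := by
  rw [ZMod.natCast_zmod_val]; ring

lemma val_add_natCast_sub {a b : ZMod n} {j : ℕ} (hj : j ≤ (b - a).val) :
    (a + (j : ZMod n) - a).val = j := by
  rw [add_sub_cancel_left]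
  exact ZMod.val_cast_of_lt (hj.trans_lt (ZMod.val_lt _))

lemma reachable_of_not_zcr (hn : 2 ≤ n) {s : Set (ZMod n)} {p q : ZMod n} (hp : p ∈ s) (hq : q ∈ s)
    (h : ∀ x ∉ s, ∀ y ∉ s, ¬ zcr n x y p q) :
    ((bpGraph n D).induce s).Reachable ⟨p, hp⟩ ⟨q, hq⟩ := by
  by_cases h1 : ∀ j ≤ (q - p).val, p + (j : ZMod n) ∈ s
  · exact reachable_of_arc hn p _ h1 (add_natCast_val_sub p q).symm hp hq
  by_cases h2 : ∀ j ≤ (p - q).val, q + (j : ZMod n) ∈ s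
  · exact (reachable_of_arc hn q _ h2 (add_natCast_val_sub q p).symm hq hp).symm
  push Not at h1 h2
  obtain ⟨j, hj, hx⟩ := h1
  obtain ⟨l, hl, hy⟩ := h2
  have hj' := val_add_natCast_sub hj
  have hl' := val_add_natCast_sub hl
  refine (h _ hx _ hy ?_).elim
  generalize p + (j : ZMod n) = x at *
  generalize q + (l : ZMod n) = y at *
  have := val_ne (show x ≠ p by rintro rfl; exact hx hp)
  have := val_ne (show x ≠ q by rintro rfl; exact hx hq)
  have := val_ne (show y ≠ p by rintro rfl; exact hy hp)
  have := val_ne (show y ≠ q by rintro rfl; exact hy hq)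
  have := val_sub_cases x p
  have := val_sub_cases y q
  have := val_sub_cases p q
  have := val_sub_cases q p
  unfold zcr Cross
  omega

lemma threeConnected_of_crossed (hn : 4 ≤ n) (h : Crossed (zcr n) Finset.univ D) :
    ThreeConnected (bpGraph n D) := by
  have hcard : Fintype.card (ZMod n) = n := ZMod.card n
  refine ⟨by omega, fun s hs => ?_⟩
  have hne : ∃ v, v ∉ s := by
    by_contra! hall
    have : s = Finset.univ := Finset.eq_univ_iff_forall.2 hall
    rw [this, Finset.card_univ] at hs
    omega
  obtain ⟨v₀, hv₀⟩ := hne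
  have : Nonempty ((↑s : Set (ZMod n))ᶜ : Set (ZMod n)) := ⟨⟨v₀, by simpa using hv₀⟩⟩
  refine ⟨?_⟩
  rintro ⟨p, hp⟩ ⟨q, hq⟩
  by_cases hsep : ∀ x ∉ (↑s : Set (ZMod n))ᶜ, ∀ y ∉ (↑s : Set (ZMod n))ᶜ, ¬ zcr n x y p q
  · exact reachable_of_not_zcr (by omega) hp hq hsep
  push Not at hsep
  obtain ⟨x, hx, y, hy, hxy⟩ := hsep
  have hs' : s = {x, y} := by
    refine (Finset.eq_of_subset_of_card_le ?_ ?_).symm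
    · intro z hz
      rcases Finset.mem_insert.1 hz with rfl | hz
      · simpa using hx
      · rw [Finset.mem_singleton.1 hz]; simpa using hy
    · rw [Finset.card_pair]
      · exact hs
      · rintro rfl
        unfold zcr Cross at hxy
        omega
  obtain ⟨u, v, huv, hc⟩ := h x (Finset.mem_univ _) y (Finset.mem_univ _)
    ⟨p, Finset.mem_univ _, q, Finset.mem_univ _, hxy⟩
  have hmem : ∀ z, (z.val ≠ x.val ∧ z.val ≠ y.val) → z ∈ (↑s : Set (ZMod n))ᶜ := by
    rintro z ⟨h1, h2⟩
    subst hs'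
    simp only [Finset.coe_insert, Finset.coe_singleton, Set.mem_compl_iff, Set.mem_insert_iff,
      Set.mem_singleton_iff, not_or]
    exact ⟨fun e => h1 (by rw [e]), fun e => h2 (by rw [e])⟩
  have hout : ∀ z ∉ (↑s : Set (ZMod n))ᶜ, z = x ∨ z = y := by
    intro z hz
    subst hs'
    simpa [or_iff_not_imp_left] using hz
  have hu : u ∈ (↑s : Set (ZMod n))ᶜ := hmem u (by unfold zcr Cross at hc; omega)
  have hv : v ∈ (↑s : Set (ZMod n))ᶜ := hmem v (by unfold zcr Cross at hc; omega)
  have hadj : ((bpGraph n D).induce (↑s : Set (ZMod n))ᶜ).Adj ⟨u, hu⟩ ⟨v, hv⟩ := by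
    change (bpGraph n D).Adj u v
    rw [bpGraph, SimpleGraph.fromEdgeSet_adj]
    refine ⟨Or.inl huv, ?_⟩
    rintro rfl
    unfold zcr Cross at hc
    omega
  have same : ∀ a b (ha : a ∈ (↑s : Set (ZMod n))ᶜ) (hb : b ∈ (↑s : Set (ZMod n))ᶜ),
      ¬ zcr n x y a b →
      ((bpGraph n D).induce (↑s : Set (ZMod n))ᶜ).Reachable ⟨a, ha⟩ ⟨b, hb⟩ := by
    intro a b ha hb hab
    refine reachable_of_not_zcr (by omega) ha hb fun z hz w hw => ?_
    rcases hout z hz with rfl | rfl <;> rcases hout w hw with rfl | rfl <;>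
      (unfold zcr Cross at *; omega)
  by_cases hpu : zcr n x y p u
  · refine (same p v hp hv ?_).trans (hadj.symm.reachable.trans (same u q hu hq ?_)) <;>
      (unfold zcr Cross at *; omega)
  · refine (same p u hp hu hpu).trans (hadj.reachable.trans (same v q hv hq ?_))
    unfold zcr Cross at *
    omega

lemma braced_of_threeConnected (hn : 4 ≤ n)
    (hD : ∀ e ∈ D, ¬ e.IsDiag ∧ ¬ IsBoundaryEdge n e) (h : ThreeConnected (bpGraph n D)) :
    Braced (zcr n) Finset.univ D where
  card := by rw [Finset.card_univ, ZMod.card]; exact hn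
  mem _ _ _ := Finset.mem_univ _
  diag p q hpq := by
    obtain ⟨h1, h2⟩ := hD _ hpq
    have hne : p ≠ q := by simpa using h1
    refine ⟨p + 1, Finset.mem_univ _, q + 1, Finset.mem_univ _, ?_⟩
    have := val_ne hne
    have := val_ne (show q ≠ p + 1 from fun e => h2 ⟨p, by rw [e]⟩)
    have := val_ne (show p ≠ q + 1 from fun e => h2 ⟨q, by rw [e, Sym2.eq_swap]⟩)
    have := val_add_one_cases (by omega) p
    have := val_add_one_cases (by omega) q
    unfold zcr Cross
    omega
  crossed := crossed_of_threeConnected (by omega) h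

lemma essential_of_minThreeConnected (hn : 4 ≤ n) (hD : Braced (zcr n) Finset.univ D)
    (h : MinThreeConnectedBP n D) : Essential (zcr n) Finset.univ D D := by
  intro p q hpq
  refine Braced.exists_private_of_not_crossed isSep_zcr hD (fun f hf => ?_)
    fun hc => h.2 _ hpq (threeConnected_of_crossed hn hc)
  rw [Finset.mem_erase]
  tauto

lemma ncard_neighborSet_eq_three_iff (hn : 4 ≤ n)
    (hD : ∀ e ∈ D, ¬ e.IsDiag ∧ ¬ IsBoundaryEdge n e) (hB : Braced (zcr n) Finset.univ D)
    (v : ZMod n) : ((bpGraph n D).neighborSet v).ncard = 3 ↔ Leaf D v := by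
  have hpm : v - 1 ≠ v + 1 := by
    intro e
    have h1 := val_add_one_cases (by omega) (v - 1)
    have h2 := val_add_one_cases (by omega) v
    rw [sub_add_cancel, e] at h1
    omega
  have hset : (bpGraph n D).neighborSet v = {v - 1, v + 1} ∪ {w | s(v, w) ∈ D} := by
    ext w
    simp only [SimpleGraph.mem_neighborSet, Set.mem_union, Set.mem_insert_iff,
      Set.mem_singleton_iff, Set.mem_ofPred_eq]
    constructor
    · intro hadj
      rw [bpGraph, SimpleGraph.fromEdgeSet_adj] at hadj
      rcases hadj.1 with hw | ⟨i, hi⟩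
      · exact Or.inr hw
      · rcases Sym2.eq_iff.1 hi with ⟨rfl, rfl⟩ | ⟨rfl, rfl⟩
        · exact Or.inl (Or.inr rfl)
        · exact Or.inl (Or.inl (by ring))
    · rintro ((rfl | rfl) | hw)
      · have := bpGraph_adj_add_one (D := D) (by omega) (v - 1)
        rw [sub_add_cancel] at this
        exact this.symm
      · exact bpGraph_adj_add_one (by omega) v
      · rw [bpGraph, SimpleGraph.fromEdgeSet_adj]
        exact ⟨Or.inl hw, by simpa using (hD _ hw).1⟩
  have hdis : Disjoint ({v - 1, v + 1} : Set (ZMod n)) {w | s(v, w) ∈ D} := by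
    rw [Set.disjoint_left]
    rintro w (rfl | rfl) hw
    · exact (hD _ hw).2 ⟨v - 1, by rw [sub_add_cancel, Sym2.eq_swap]⟩
    · exact (hD _ hw).2 ⟨v, rfl⟩
  rw [hset, Set.ncard_union_eq hdis, Set.ncard_pair hpm]
  obtain ⟨w, hw⟩ := hB.exists_brace isSep_zcr (Finset.mem_univ v)
  constructor
  · intro h w₁ w₂ h₁ h₂
    obtain ⟨a, ha⟩ := Set.ncard_eq_one.1 (show {w | s(v, w) ∈ D}.ncard = 1 by omega)
    have e₁ : w₁ ∈ ({a} : Set (ZMod n)) := ha ▸ h₁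
    have e₂ : w₂ ∈ ({a} : Set (ZMod n)) := ha ▸ h₂
    exact e₁.trans e₂.symm
  · intro h
    have : {w | s(v, w) ∈ D} = {w} := by
      ext w'
      exact ⟨fun h' => h w' w h' hw, fun h' => by rw [Set.mem_singleton_iff.1 h']; exact hw⟩
    rw [this, Set.ncard_singleton]

lemma exists_arc_of_leavesConsecutive (h : LeavesConsecutive (zcr n) Finset.univ D) :
    ∃ (i : ZMod n) (k : ℕ),
      {v : ZMod n | Leaf D v} = {v : ZMod n | ∃ t : ℕ, t < k ∧ v = i + (t : ZMod n)} := by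
  by_cases hall : ∀ v, Leaf D v
  · refine ⟨0, n, Set.ext fun v => ⟨fun _ => ⟨v.val, v.val_lt, ?_⟩, fun _ => hall v⟩⟩
    rw [ZMod.natCast_zmod_val, zero_add]
  push Not at hall
  obtain ⟨u, hu⟩ := hall
  by_cases hex : ∃ v, Leaf D v
  swap
  · refine ⟨0, 0, Set.ext fun v => ⟨fun hv => (hex ⟨v, hv⟩).elim, ?_⟩⟩
    rintro ⟨t, ht, -⟩
    omega
  obtain ⟨i, hi, hmin⟩ := (Finset.univ.filter (Leaf D)).exists_min_image (fun v => (v - u).val)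
    (by obtain ⟨v, hv⟩ := hex; exact ⟨v, by simpa using hv⟩)
  replace hi : Leaf D i := by simpa using hi
  have hk : ∃ k : ℕ, ¬ Leaf D (i + (k : ZMod n)) :=
    ⟨(u - i).val, by rwa [add_natCast_val_sub]⟩
  have hks := Nat.find_spec hk
  have hkm : ∀ t < Nat.find hk, Leaf D (i + (t : ZMod n)) := fun t ht =>
    not_not.1 (Nat.find_min hk ht)
  have hku : Nat.find hk ≤ (u - i).val := Nat.find_min' hk (by rwa [add_natCast_val_sub])
  generalize Nat.find hk = k at *
  refine ⟨i, k, Set.ext fun p => ⟨fun hp => ?_, ?_⟩⟩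
  · replace hp : Leaf D p := hp
    by_contra hno
    have hkp : k ≤ (p - i).val := by
      by_contra! hlt
      exact hno ⟨_, hlt, (add_natCast_val_sub i p).symm⟩
    have hw := val_add_natCast_sub hku
    have hpw : p ≠ i + (k : ZMod n) := by rintro rfl; exact hks hp
    have hiw : i ≠ i + (k : ZMod n) := fun e => hks (e ▸ hi)
    generalize i + (k : ZMod n) = w at *
    refine h u (Finset.mem_univ _) w (Finset.mem_univ _) i (Finset.mem_univ _) p
      (Finset.mem_univ _) ?_ hu hks hi hp
    have := hmin p (by simpa using hp)
    have := val_ne hpw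
    have := val_ne hiw
    have := val_ne (show i ≠ u by rintro rfl; exact hu hi)
    have := val_ne (show p ≠ u by rintro rfl; exact hu hp)
    have := val_sub_cases i u
    have := val_sub_cases p u
    have := val_sub_cases u i
    have := val_sub_cases p i
    have := val_sub_cases w i
    unfold zcr Cross
    omega
  · rintro ⟨t, ht, rfl⟩
    exact hkm t ht

end Polygon

end BracedPolygon

/-- In a minimally 3-connected braced polygonal circuit on `n`
vertices, the vertices of degree 3 form a consecutive segment of the boundary
polygon. -/
theorem stmt16 (n : ℕ) [NeZero n] (hn : 4 ≤ n) (B : Finset (Sym2 (ZMod n)))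
    (hB : ∀ e ∈ B, ¬ e.IsDiag ∧ ¬ IsBoundaryEdge n e)
    (hcard : B.card = n - 2)
    (hcircuit : ∀ s : Finset (ZMod n), 2 ≤ s.card → s.card < n →
      {e ∈ (bpGraph n B).edgeSet | ∀ v ∈ e, v ∈ s}.ncard ≤ 2 * s.card - 3)
    (hmin : MinThreeConnectedBP n B) :
    ∃ (i : ZMod n) (k : ℕ),
      {v : ZMod n | ((bpGraph n B).neighborSet v).ncard = 3} =
        {v : ZMod n | ∃ t : ℕ, t < k ∧ v = i + (t : ZMod n)} := by
  have hbr := BracedPolygon.braced_of_threeConnected hn hB hmin.1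
  have hc := (hbr.essentialBound BracedPolygon.isSep_zcr subset_rfl
    (BracedPolygon.essential_of_minThreeConnected hn hbr hmin)).2
    (by rw [Finset.card_univ, ZMod.card]; omega)
  simp only [BracedPolygon.ncard_neighborSet_eq_three_iff hn hB hbr]
  exact BracedPolygon.exists_arc_of_leavesConsecutive hc.2
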